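/- arXiv:1909.07448 — 4 statements merged into one kernel-verified Lean document; each statement's English description precedes it below -/
import Mathlib

section
/- Let L > 0 and let f : ℝ → ℝ be a continuously differentiable L-periodic function (f(x+L) = f(x) for all x) all of whose zeros are non-degenerate, i.e., f(x) = 0 implies f′(x) ≠ 0. Then the set Z := { x ∈ [0, L) : f(x) = 0 } is finite, and the number of points x ∈ Z with f′(x) > 0 equals the number of points x ∈ Z with f′(x) < 0; in particular, the total number of zeros of f in one period is even. -/
/-- The sign of `f` immediately to the left of `x`, provided `x` is not a degenerate zero. -/
noncomputable def leftSign (f : ℝ → ℝ) (x : ℝ) : ℤ :=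
  if f x = 0 then -(SignType.sign (deriv f x) : ℤ) else (SignType.sign (f x) : ℤ)

/-- On `[a, b)` the zeros of `f` are finite in number, and the upward crossings minus the downward
crossings account for the change of the left sign. -/
def CrossingBalance (f : ℝ → ℝ) (a b : ℝ) : Prop :=
  Set.Finite {x | x ∈ Set.Ico a b ∧ f x = 0} ∧
    2 * ((Set.ncard {x | x ∈ Set.Ico a b ∧ f x = 0 ∧ 0 < deriv f x} : ℤ) -
      Set.ncard {x | x ∈ Set.Ico a b ∧ f x = 0 ∧ deriv f x < 0}) = leftSign f b - leftSign f a

theorem leftSign_neg (f : ℝ → ℝ) (x : ℝ) : leftSign (-f) x = -leftSign f x := by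
  unfold leftSign
  by_cases h : f x = 0 <;> simp [h, Left.sign_neg, deriv.neg']

theorem CrossingBalance.of_neg {f : ℝ → ℝ} {a b : ℝ} (h : CrossingBalance (-f) a b) :
    CrossingBalance f a b := by
  obtain ⟨h₁, h₂⟩ := h
  simp only [leftSign_neg, deriv.neg', Pi.neg_apply, neg_eq_zero, Left.neg_pos_iff,
    Left.neg_neg_iff] at h₁ h₂
  exact ⟨h₁, by linarith⟩

theorem CrossingBalance.refl (f : ℝ → ℝ) (a : ℝ) : CrossingBalance f a a := by
  simp [CrossingBalance]

theorem CrossingBalance.trans {f : ℝ → ℝ} {a b c : ℝ} (hab : a ≤ b) (hbc : b ≤ c)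
    (h₁ : CrossingBalance f a b) (h₂ : CrossingBalance f b c) : CrossingBalance f a c := by
  have hsplit : ∀ p : ℝ → Prop, {x | x ∈ Set.Ico a c ∧ p x} =
      {x | x ∈ Set.Ico a b ∧ p x} ∪ {x | x ∈ Set.Ico b c ∧ p x} := by
    intro p
    ext x
    simp only [← Set.Ico_union_Ico_eq_Ico hab hbc, Set.mem_ofPred_eq, Set.mem_union, or_and_right]
  have hcard : ∀ p : ℝ → Prop, (∀ x, p x → f x = 0) →
      Set.ncard {x | x ∈ Set.Ico a c ∧ p x} =
      Set.ncard {x | x ∈ Set.Ico a b ∧ p x} + Set.ncard {x | x ∈ Set.Ico b c ∧ p x} := by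
    intro p hp
    rw [hsplit p]
    refine Set.ncard_union_eq ?_ (h₁.1.subset fun x hx => ⟨hx.1, hp x hx.2⟩)
      (h₂.1.subset fun x hx => ⟨hx.1, hp x hx.2⟩)
    exact Set.disjoint_left.2 fun x hx hx' => absurd hx.1.2 (not_lt.2 hx'.1.1)
  refine ⟨by rw [hsplit]; exact h₁.1.union h₂.1, ?_⟩
  rw [hcard _ fun x hx => hx.1, hcard _ fun x hx => hx.1]
  push_cast
  linarith [h₁.2, h₂.2]

theorem exists_ball_crossingBalance_of_pos {f : ℝ → ℝ} {x : ℝ} (hf : Continuous f)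
    (hx : 0 < f x) :
    ∃ δ > 0, ∀ a ∈ Metric.ball x δ, ∀ b ∈ Metric.ball x δ, a ≤ b → CrossingBalance f a b := by
  obtain ⟨δ, hδ, h⟩ := Metric.eventually_nhds_iff_ball.1
    (hf.continuousAt.eventually (lt_mem_nhds hx))
  refine ⟨δ, hδ, fun a ha b hb _ => ?_⟩
  have hempty : ∀ p : ℝ → Prop, {y | y ∈ Set.Ico a b ∧ f y = 0 ∧ p y} = ∅ := by
    refine fun p => Set.eq_empty_of_forall_notMem fun y hy => ?_
    have hyb : y ∈ Metric.ball x δ :=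
      (convex_ball x δ).ordConnected.out ha hb ⟨hy.1.1, hy.1.2.le⟩
    exact (h y hyb).ne' hy.2.1
  refine ⟨by simpa using congrArg Set.Finite (hempty fun _ => True), ?_⟩
  rw [hempty, hempty]
  simp [leftSign, (h a ha).ne', (h b hb).ne', sign_pos (h a ha), sign_pos (h b hb)]

theorem exists_ball_crossingBalance_of_deriv_pos {f : ℝ → ℝ} {x : ℝ} (hf : ContDiff ℝ 1 f)
    (hx : f x = 0) (hd : 0 < deriv f x) :
    ∃ δ > 0, ∀ a ∈ Metric.ball x δ, ∀ b ∈ Metric.ball x δ, a ≤ b → CrossingBalance f a b := by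
  obtain ⟨δ, hδ, h⟩ := Metric.eventually_nhds_iff_ball.1
    ((hf.continuous_deriv le_rfl).continuousAt.eventually (lt_mem_nhds hd))
  have hmono : StrictMonoOn f (Metric.ball x δ) :=
    strictMonoOn_of_deriv_pos (convex_ball x δ) hf.continuous.continuousOn
      fun y hy => h y (interior_subset hy)
  have hxb : x ∈ Metric.ball x δ := Metric.mem_ball_self hδ
  have hzero : ∀ y ∈ Metric.ball x δ, (f y = 0 ↔ y = x) := fun y hy => by
    rw [← hx]; exact hmono.injOn.eq_iff hy hxb
  have hle : ∀ y ∈ Metric.ball x δ, y ≤ x → leftSign f y = -1 := by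
    intro y hy hyx
    rcases hyx.eq_or_lt with rfl | hlt
    · simp [leftSign, hx, sign_pos hd]
    · have : f y < 0 := hx ▸ hmono hy hxb hlt
      simp [leftSign, this.ne, sign_neg this]
  have hgt : ∀ y ∈ Metric.ball x δ, x < y → leftSign f y = 1 := by
    intro y hy hlt
    have : 0 < f y := hx ▸ hmono hxb hy hlt
    simp [leftSign, this.ne', sign_pos this]
  refine ⟨δ, hδ, fun a ha b hb hab => ?_⟩
  have hIco : ∀ y ∈ Set.Ico a b, y ∈ Metric.ball x δ := fun y hy =>
    (convex_ball x δ).ordConnected.out ha hb ⟨hy.1, hy.2.le⟩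
  have hneg : {y | y ∈ Set.Ico a b ∧ f y = 0 ∧ deriv f y < 0} = ∅ :=
    Set.eq_empty_of_forall_notMem fun y hy => (h y (hIco y hy.1)).not_gt hy.2.2
  refine ⟨(Set.finite_singleton x).subset fun y hy => (hzero y (hIco y hy.1)).1 hy.2, ?_⟩
  by_cases hxab : x ∈ Set.Ico a b
  · have hpos : {y | y ∈ Set.Ico a b ∧ f y = 0 ∧ 0 < deriv f y} = {x} := by
      refine Set.Subset.antisymm (fun y hy => (hzero y (hIco y hy.1)).1 hy.2.1) ?_
      rintro y rfl
      exact ⟨hxab, hx, hd⟩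
    rw [hpos, hneg, hle a ha hxab.1, hgt b hb hxab.2]
    simp
  · have hpos : {y | y ∈ Set.Ico a b ∧ f y = 0 ∧ 0 < deriv f y} = ∅ := by
      refine Set.eq_empty_of_forall_notMem fun y hy => hxab ?_
      exact (hzero y (hIco y hy.1)).1 hy.2.1 ▸ hy.1
    rw [hpos, hneg]
    rcases lt_or_ge x a with hxa | hax
    · simp [hgt a ha hxa, hgt b hb (hxa.trans_le hab)]
    · have hbx : b ≤ x := not_lt.1 fun hlt => hxab ⟨hax, hlt⟩
      simp [hle a ha hax, hle b hb hbx]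

theorem exists_ball_crossingBalance {f : ℝ → ℝ} (hf : ContDiff ℝ 1 f) {x : ℝ}
    (hnd : f x = 0 → deriv f x ≠ 0) :
    ∃ δ > 0, ∀ a ∈ Metric.ball x δ, ∀ b ∈ Metric.ball x δ, a ≤ b → CrossingBalance f a b := by
  suffices (∃ δ > 0, ∀ a ∈ Metric.ball x δ, ∀ b ∈ Metric.ball x δ, a ≤ b →
      CrossingBalance f a b) ∨ (∃ δ > 0, ∀ a ∈ Metric.ball x δ, ∀ b ∈ Metric.ball x δ, a ≤ b →
      CrossingBalance (-f) a b) by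
    rcases this with h | ⟨δ, hδ, h⟩
    · exact h
    · exact ⟨δ, hδ, fun a ha b hb hab => (h a ha b hb hab).of_neg⟩
  rcases lt_trichotomy (f x) 0 with hx | hx | hx
  · exact .inr (exists_ball_crossingBalance_of_pos hf.neg.continuous (by simpa using hx))
  · rcases (hnd hx).lt_or_gt with hd | hd
    · exact .inr (exists_ball_crossingBalance_of_deriv_pos hf.neg (by simpa using hx)
        (by simpa [deriv.neg'] using hd))
    · exact .inl (exists_ball_crossingBalance_of_deriv_pos hf hx hd)
  · exact .inl (exists_ball_crossingBalance_of_pos hf.continuous hx)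

theorem crossingBalance_of_contDiff {f : ℝ → ℝ} (hf : ContDiff ℝ 1 f)
    (hnd : ∀ x, f x = 0 → deriv f x ≠ 0) {a b : ℝ} (hab : a ≤ b) : CrossingBalance f a b := by
  choose δ hδ h using fun x => exists_ball_crossingBalance hf (hnd x)
  obtain ⟨t, ht₀, htm, ⟨n, hn⟩, hts⟩ := exists_monotone_Icc_subset_open_cover_Icc hab
    (c := fun x => {y : Set.Icc a b | (y : ℝ) ∈ Metric.ball x (δ x)})
    (fun x => Metric.isOpen_ball.preimage continuous_subtype_val)
    fun y _ => Set.mem_iUnion.2 ⟨y, Metric.mem_ball_self (hδ y)⟩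
  have hbal : ∀ m, CrossingBalance f a (t m) := by
    intro m
    induction m with
    | zero => rw [ht₀]; exact .refl f a
    | succ m ih =>
      have hm : t m ≤ t (m + 1) := htm m.le_succ
      obtain ⟨x, hx⟩ := hts m
      exact ih.trans (t m).2.1 hm
        (h x _ (hx (Set.left_mem_Icc.2 hm)) _ (hx (Set.right_mem_Icc.2 hm)) hm)
  exact hn n le_rfl ▸ hbal n

theorem stmt5
    (L : ℝ) (hL : 0 < L) (f : ℝ → ℝ) (hf : ContDiff ℝ 1 f)
    (hper : ∀ x, f (x + L) = f x)
    (hnd : ∀ x, f x = 0 → deriv f x ≠ 0) :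
    Set.Finite {x | x ∈ Set.Ico (0:ℝ) L ∧ f x = 0} ∧
    Set.ncard {x | x ∈ Set.Ico (0:ℝ) L ∧ f x = 0 ∧ 0 < deriv f x} =
      Set.ncard {x | x ∈ Set.Ico (0:ℝ) L ∧ f x = 0 ∧ deriv f x < 0} ∧
    Even (Set.ncard {x | x ∈ Set.Ico (0:ℝ) L ∧ f x = 0}) := by
  obtain ⟨hfin, hbal⟩ := crossingBalance_of_contDiff hf hnd hL.le
  have hderiv : deriv f L = deriv f 0 := by
    have := deriv_comp_add_const f L 0
    rwa [funext hper, zero_add, eq_comm] at this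
  have hsign : leftSign f L = leftSign f 0 := by
    have : f L = f 0 := by simpa using hper 0
    simp only [leftSign, this, hderiv]
  rw [hsign] at hbal
  have heq : Set.ncard {x | x ∈ Set.Ico (0:ℝ) L ∧ f x = 0 ∧ 0 < deriv f x} =
      Set.ncard {x | x ∈ Set.Ico (0:ℝ) L ∧ f x = 0 ∧ deriv f x < 0} := by omega
  refine ⟨hfin, heq, ?_⟩
  have hunion : {x | x ∈ Set.Ico (0:ℝ) L ∧ f x = 0} =
      {x | x ∈ Set.Ico (0:ℝ) L ∧ f x = 0 ∧ 0 < deriv f x} ∪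
      {x | x ∈ Set.Ico (0:ℝ) L ∧ f x = 0 ∧ deriv f x < 0} := by
    ext x
    constructor
    · rintro ⟨hx, h₀⟩
      exact (hnd x h₀).lt_or_gt.symm.imp (fun h => ⟨hx, h₀, h⟩) fun h => ⟨hx, h₀, h⟩
    · rintro (h | h) <;> exact ⟨h.1, h.2.1⟩
  rw [hunion, Set.ncard_union_eq
    (Set.disjoint_left.2 fun x hx hx' => hx.2.2.not_gt hx'.2.2)
    (hfin.subset fun x hx => ⟨hx.1, hx.2.1⟩) (hfin.subset fun x hx => ⟨hx.1, hx.2.1⟩), heq]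
  exact ⟨_, rfl⟩
end

section
/- Let κ, τ : ℝ → ℝ be smooth functions and define, for α, θ ∈ ℝ and r > 0, the functions I⁽⁰⁾(r) := r²/2, I⁽¹⁾(α,r,θ) := (3(r³−r)/8)·κ(α)·cos θ, X_r⁽¹⁾(α,r,θ) := −((3r²−3)/8)·(τ(α)κ(α)sin θ + κ′(α)cos θ), and X_θ⁽¹⁾(α,r,θ) := ((r²−3)/(8r))·(−τ(α)κ(α)cos θ + κ′(α)sin θ). Then the first-order transport identity ∂I⁽¹⁾/∂α + (∂I⁽⁰⁾/∂r)·X_r⁽¹⁾ − τ(α)·∂I⁽¹⁾/∂θ + (∂I⁽⁰⁾/∂θ)·X_θ⁽¹⁾ = 0 holds at every point (α, r, θ) with r > 0. -/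
theorem stmt6
    (κ τ : ℝ → ℝ) (hκ : ContDiff ℝ (⊤ : ℕ∞) κ) (hτ : ContDiff ℝ (⊤ : ℕ∞) τ)
    (I0 : ℝ → ℝ) (hI0 : ∀ r, I0 r = r ^ 2 / 2)
    (I1 : ℝ → ℝ → ℝ → ℝ)
    (hI1 : ∀ α r θ, I1 α r θ = 3 * (r ^ 3 - r) / 8 * κ α * Real.cos θ)
    (Xr1 : ℝ → ℝ → ℝ → ℝ)
    (hXr1 : ∀ α r θ, Xr1 α r θ =
      -((3 * r ^ 2 - 3) / 8) * (τ α * κ α * Real.sin θ + deriv κ α * Real.cos θ))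
    (Xθ1 : ℝ → ℝ → ℝ → ℝ)
    (hXθ1 : ∀ α r θ, Xθ1 α r θ =
      (r ^ 2 - 3) / (8 * r) * (-(τ α * κ α) * Real.cos θ + deriv κ α * Real.sin θ)) :
    ∀ (α r θ : ℝ), 0 < r →
      deriv (fun a => I1 a r θ) α + deriv I0 r * Xr1 α r θ
        - τ α * deriv (fun t => I1 α r t) θ
        + deriv (fun _ : ℝ => I0 r) θ * Xθ1 α r θ = 0 := by
  intro α r θ _
  have hα : HasDerivAt (fun a => I1 a r θ)
      (3 * (r ^ 3 - r) / 8 * deriv κ α * Real.cos θ) α := by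
    simp only [hI1]
    have hd : DifferentiableAt ℝ κ α := hκ.differentiable (by simp) α
    exact (hd.hasDerivAt.const_mul _).mul_const _
  have hr : HasDerivAt I0 r r := by
    rw [funext hI0]
    exact ((hasDerivAt_pow 2 r).div_const 2).congr_deriv (by simp)
  have hθ : HasDerivAt (fun t => I1 α r t)
      (3 * (r ^ 3 - r) / 8 * κ α * -Real.sin θ) θ := by
    simp only [hI1]
    exact (Real.hasDerivAt_cos θ).const_mul _
  rw [hα.deriv, hr.deriv, hθ.deriv, deriv_const, hXr1]
  ring
end

section
/- Let k ∈ ℤ³ be a nonzero integer vector, set J := ‖k‖ (its Euclidean norm), and let b ∈ ℝ³ satisfy k·b = 0. Define U : ℝ³ → ℝ³ by U(x) := cos(k·x)·b + (1/J)·sin(k·x)·(b × k), where × is the cross product in ℝ³ and k·x is the Euclidean inner product. Then U is smooth and satisfies curl U = J·U and div U = 0 at every point of ℝ³; moreover U(x + 2πm) = U(x) for every m ∈ ℤ³, so U defines a Beltrami field with eigenvalue J = |k| on the flat torus 𝕋³ = (ℝ/2πℤ)³. -/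
noncomputable section

/-- Euclidean 3-space. -/
abbrev E3 := EuclideanSpace ℝ (Fin 3)

/-- Build a point of Euclidean 3-space from a plain function. -/
def toE3 (v : Fin 3 → ℝ) : E3 := (WithLp.equiv 2 (Fin 3 → ℝ)).symm v

/-- Euclidean inner product on `E3`. -/
def dot3 (a b : E3) : ℝ := a 0 * b 0 + a 1 * b 1 + a 2 * b 2

/-- Cross product on `E3`. -/
def cross3 (a b : E3) : E3 :=
  toE3 ![a 1 * b 2 - a 2 * b 1, a 2 * b 0 - a 0 * b 2, a 0 * b 1 - a 1 * b 0]

/-- Partial derivative in the `i`-th coordinate direction. -/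
def pd3 (i : Fin 3) (f : E3 → ℝ) (x : E3) : ℝ :=
  fderiv ℝ f x (EuclideanSpace.single i 1)

/-- Curl of a vector field on `E3`. -/
def curl3 (u : E3 → E3) (x : E3) : E3 :=
  toE3 ![pd3 1 (fun y => u y 2) x - pd3 2 (fun y => u y 1) x,
         pd3 2 (fun y => u y 0) x - pd3 0 (fun y => u y 2) x,
         pd3 0 (fun y => u y 1) x - pd3 1 (fun y => u y 0) x]

/-- Divergence of a vector field on `E3`. -/
def div3 (u : E3 → E3) (x : E3) : ℝ :=
  pd3 0 (fun y => u y 0) x + pd3 1 (fun y => u y 1) x + pd3 2 (fun y => u y 2) x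

theorem dot3_add_right (a x y : E3) : dot3 a (x + y) = dot3 a x + dot3 a y := by
  simp only [dot3, PiLp.add_apply]
  ring

theorem contDiff_dot3 (a : E3) {n : WithTop ℕ∞} : ContDiff ℝ n (dot3 a) := by
  unfold dot3
  fun_prop

theorem hasFDerivAt_dot3 (a x : E3) :
    HasFDerivAt (dot3 a) (a 0 • (EuclideanSpace.proj 0 : E3 →L[ℝ] ℝ)
      + a 1 • (EuclideanSpace.proj 1 : E3 →L[ℝ] ℝ)
      + a 2 • (EuclideanSpace.proj 2 : E3 →L[ℝ] ℝ)) x :=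
  (a 0 • (EuclideanSpace.proj 0 : E3 →L[ℝ] ℝ)
      + a 1 • (EuclideanSpace.proj 1 : E3 →L[ℝ] ℝ)
      + a 2 • (EuclideanSpace.proj 2 : E3 →L[ℝ] ℝ) : E3 →L[ℝ] ℝ).hasFDerivAt

/-- Partial derivatives of a plane wave with wave vector `a`. -/
theorem pd3_plane_wave (a x : E3) (c d : ℝ) (i : Fin 3) :
    pd3 i (fun y => Real.cos (dot3 a y) * c + Real.sin (dot3 a y) * d) x =
      a i * (Real.cos (dot3 a x) * d - Real.sin (dot3 a x) * c) := by
  have h := hasFDerivAt_dot3 a x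
  rw [pd3, ((h.cos.mul_const c).fun_add (h.sin.mul_const d)).fderiv]
  fin_cases i <;> simp <;> ring

theorem stmt9
    (k : Fin 3 → ℤ) (hk : k ≠ 0)
    (kE : E3) (hkE : kE = toE3 (fun i => (k i : ℝ)))
    (J : ℝ) (hJ : J = ‖kE‖)
    (b : E3) (hb : dot3 kE b = 0)
    (U : E3 → E3)
    (hU : ∀ x, U x =
      Real.cos (dot3 kE x) • b + (J⁻¹ * Real.sin (dot3 kE x)) • cross3 b kE) :
    ContDiff ℝ (⊤ : ℕ∞) U ∧
    (∀ x, curl3 U x = J • U x) ∧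
    (∀ x, div3 U x = 0) ∧
    (∀ (x : E3) (m : Fin 3 → ℤ),
      U (x + toE3 (fun i => 2 * Real.pi * (m i))) = U x) := by
  have hJ2 : J ^ 2 = kE 0 ^ 2 + kE 1 ^ 2 + kE 2 ^ 2 := by
    rw [hJ, EuclideanSpace.norm_sq_eq, Fin.sum_univ_three]
    simp only [Real.norm_eq_abs, sq_abs]
  have hJ0 : J ≠ 0 := by
    rintro rfl
    refine hk (funext fun i => ?_)
    have h := congrArg (fun v : E3 => v i) (norm_eq_zero.mp hJ.symm)
    simpa [hkE, toE3] using h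
  have hJinv : J⁻¹ * (kE 0 ^ 2 + kE 1 ^ 2 + kE 2 ^ 2) = J := by
    rw [← hJ2]
    field_simp
  have hcoord (i : Fin 3) : (fun y => U y i) = fun y =>
      Real.cos (dot3 kE y) * b i + Real.sin (dot3 kE y) * (J⁻¹ * cross3 b kE i) := by
    funext y
    simp only [hU, PiLp.add_apply, PiLp.smul_apply, smul_eq_mul]
    ring
  refine ⟨?_, fun x => ?_, fun x => ?_, fun x m => ?_⟩
  · rw [funext hU]
    have h := contDiff_dot3 kE (n := ((⊤ : ℕ∞) : WithTop ℕ∞))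
    exact (h.cos.smul contDiff_const).add ((contDiff_const.mul h.sin).smul contDiff_const)
  · simp only [dot3] at hb
    simp only [curl3, hcoord, pd3_plane_wave]
    rw [hU]
    ext i
    fin_cases i <;> simp [cross3, toE3]
    · linear_combination Real.cos (dot3 kE x) * (b 0 * hJinv - J⁻¹ * kE 0 * hb)
        - Real.sin (dot3 kE x) * (b 1 * kE 2 - b 2 * kE 1) * mul_inv_cancel₀ hJ0
    · linear_combination Real.cos (dot3 kE x) * (b 1 * hJinv - J⁻¹ * kE 1 * hb)
        - Real.sin (dot3 kE x) * (b 2 * kE 0 - b 0 * kE 2) * mul_inv_cancel₀ hJ0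
    · linear_combination Real.cos (dot3 kE x) * (b 2 * hJinv - J⁻¹ * kE 2 * hb)
        - Real.sin (dot3 kE x) * (b 0 * kE 1 - b 1 * kE 0) * mul_inv_cancel₀ hJ0
  · simp only [dot3] at hb
    simp only [div3, hcoord, pd3_plane_wave]
    simp [cross3, toE3]
    linear_combination -Real.sin (dot3 kE x) * hb
  · have hper : dot3 kE (x + toE3 (fun i => 2 * Real.pi * (m i))) =
        dot3 kE x + ((k 0 * m 0 + k 1 * m 1 + k 2 * m 2 : ℤ) : ℝ) * (2 * Real.pi) := by
      rw [dot3_add_right, hkE]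
      simp [dot3, toE3]
      ring
    rw [hU, hU, hper, Real.cos_add_int_mul_two_pi, Real.sin_add_int_mul_two_pi]
end
end

section
/- Let λ be a nonzero real number, and let K ⊂ ℝ³ be a bounded open set whose complement ℝ³ ∖ K is connected. Let v : ℝ³ → ℝ³ be smooth on K and satisfy the Beltrami equation curl v = λ·v at every point of K. Then for every compact set K′ ⊆ K, every natural number m, and every δ₀ > 0, there exist a smooth vector field u : ℝ³ → ℝ³ and a constant C > 0 such that: (i) curl u = λ·u at every point of ℝ³; (ii) ‖u(x)‖ ≤ C/(1+‖x‖) for all x ∈ ℝ³; and (iii) ‖D^j(u−v)(x)‖ ≤ δ₀ for all x ∈ K′ and all 0 ≤ j ≤ m, where D^j denotes the j-th iterated (Fréchet) derivative. -/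
noncomputable section

namespace Beltrami

open MeasureTheory Filter Topology Metric Set
open scoped ContDiff Manifold RealInnerProductSpace Pointwise

section PartialDerivatives

variable {f g : E3 → ℝ} {x : E3}

lemma contDiffAt_pd3 (i : Fin 3) (hf : ContDiffAt ℝ ∞ f x) : ContDiffAt ℝ ∞ (pd3 i f) x :=
  (hf.fderiv_right (m := ∞) (by simp)).clm_apply contDiffAt_const

lemma contDiff_pd3 (i : Fin 3) (hf : ContDiff ℝ ∞ f) : ContDiff ℝ ∞ (pd3 i f) :=
  contDiff_iff_contDiffAt.2 fun _ => contDiffAt_pd3 i hf.contDiffAt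

lemma pd3_congr (i : Fin 3) (h : f =ᶠ[𝓝 x] g) : pd3 i f =ᶠ[𝓝 x] pd3 i g := by
  filter_upwards [h.fderiv (𝕜 := ℝ)] with y hy
  simp [pd3, hy]

lemma eventually_differentiableAt (hf : ContDiffAt ℝ ∞ f x) :
    ∀ᶠ y in 𝓝 x, DifferentiableAt ℝ f y := by
  have h1 : ContDiffAt ℝ 1 f x := hf.of_le (mod_cast le_top)
  filter_upwards [h1.eventually (by simp)] with y hy using hy.differentiableAt (by simp)

lemma differentiableAt_pd3 (i : Fin 3) (hf : ContDiffAt ℝ ∞ f x) :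
    DifferentiableAt ℝ (pd3 i f) x :=
  (contDiffAt_pd3 i hf).differentiableAt (by simp)

lemma pd3_add (i : Fin 3) (hf : DifferentiableAt ℝ f x) (hg : DifferentiableAt ℝ g x) :
    pd3 i (fun y => f y + g y) x = pd3 i f x + pd3 i g x := by
  have := fderiv_fun_add hf hg
  simp [pd3, this]

lemma pd3_sub (i : Fin 3) (hf : DifferentiableAt ℝ f x) (hg : DifferentiableAt ℝ g x) :
    pd3 i (fun y => f y - g y) x = pd3 i f x - pd3 i g x := by
  have := fderiv_fun_sub hf hg
  simp [pd3, this]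

lemma pd3_const_mul (i : Fin 3) (c : ℝ) (hf : DifferentiableAt ℝ f x) :
    pd3 i (fun y => c * f y) x = c * pd3 i f x := by
  have := fderiv_const_mul hf c
  simp only [pd3, this]
  simp

lemma pd3_comp_sub_const (i : Fin 3) (f : E3 → ℝ) (a x : E3) :
    pd3 i (fun y => f (y - a)) x = pd3 i f (x - a) := by
  simp [pd3, fderiv_comp_sub]

lemma pd3_comm (i j : Fin 3) (hf : ContDiffAt ℝ ∞ f x) :
    pd3 i (pd3 j f) x = pd3 j (pd3 i f) x := by
  have hd : DifferentiableAt ℝ (fderiv ℝ f) x :=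
    (hf.fderiv_right (m := ∞) (by simp)).differentiableAt (by simp)
  have key : ∀ a b : Fin 3, pd3 a (pd3 b f) x
      = fderiv ℝ (fderiv ℝ f) x (EuclideanSpace.single a 1) (EuclideanSpace.single b 1) := by
    intro a b
    change fderiv ℝ (fun y => fderiv ℝ f y (EuclideanSpace.single b 1)) x _ = _
    rw [fderiv_clm_apply hd (by fun_prop)]
    simp
  rw [key, key]
  exact (hf.isSymmSndFDerivAt (by simpa using ENat.LEInfty.out)) _ _

lemma norm_iteratedFDeriv_pd3_le (i : Fin 3) (n : ℕ) (hf : ContDiffAt ℝ ∞ f x) :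
    ‖iteratedFDeriv ℝ n (pd3 i f) x‖ ≤ ‖iteratedFDeriv ℝ (n + 1) f x‖ := by
  have hd : ContDiffAt ℝ ∞ (fderiv ℝ f) x := hf.fderiv_right (m := ∞) (by simp)
  have h := (ContinuousLinearMap.apply ℝ ℝ
    (EuclideanSpace.single i 1 : E3)).norm_iteratedFDeriv_comp_left (n := n) hd (mod_cast le_top)
  refine (h.trans ?_)
  rw [norm_iteratedFDeriv_fderiv]
  refine (mul_le_of_le_one_left (norm_nonneg _) ?_)
  refine ContinuousLinearMap.opNorm_le_bound _ zero_le_one fun L => ?_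
  simpa using L.le_opNorm (EuclideanSpace.single i 1 : E3)

lemma pd3_eq_zero_of_notMem_tsupport (i : Fin 3) (hx : x ∉ tsupport f) : pd3 i f x = 0 := by
  have := pd3_congr i (notMem_tsupport_iff_eventuallyEq.1 hx)
  rw [this.eq_of_nhds]
  simp [pd3]

lemma hasCompactSupport_pd3 (i : Fin 3) (hf : HasCompactSupport f) :
    HasCompactSupport (pd3 i f) :=
  HasCompactSupport.intro hf fun _ hx => pd3_eq_zero_of_notMem_tsupport i hx

end PartialDerivatives

section Helmholtz

/-- The Laplacian of a scalar function. -/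
def lap (f : E3 → ℝ) (x : E3) : ℝ := ∑ i, pd3 i (pd3 i f) x

/-- The Helmholtz operator `Δ + k²`. -/
def helm (k : ℝ) (f : E3 → ℝ) (x : E3) : ℝ := lap f x + k ^ 2 * f x

variable {k : ℝ} {f g : E3 → ℝ} {x : E3}

lemma contDiffAt_helm (k : ℝ) (hf : ContDiffAt ℝ ∞ f x) : ContDiffAt ℝ ∞ (helm k f) x :=
  (ContDiffAt.sum fun i _ => contDiffAt_pd3 i (contDiffAt_pd3 i hf)).add (contDiffAt_const.mul hf)

lemma contDiff_helm (k : ℝ) (hf : ContDiff ℝ ∞ f) : ContDiff ℝ ∞ (helm k f) :=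
  contDiff_iff_contDiffAt.2 fun _ => contDiffAt_helm k hf.contDiffAt

lemma helm_congr (k : ℝ) (h : f =ᶠ[𝓝 x] g) : helm k f x = helm k g x := by
  simp only [helm, lap, h.eq_of_nhds, (pd3_congr _ (pd3_congr _ h)).eq_of_nhds]

lemma helm_add (k : ℝ) (hf : ContDiffAt ℝ ∞ f x) (hg : ContDiffAt ℝ ∞ g x) :
    helm k (fun y => f y + g y) x = helm k f x + helm k g x := by
  have h : ∀ i, pd3 i (pd3 i (fun y => f y + g y)) x = pd3 i (pd3 i f) x + pd3 i (pd3 i g) x := by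
    intro i
    rw [← pd3_add i (differentiableAt_pd3 i hf) (differentiableAt_pd3 i hg)]
    refine (pd3_congr i ?_).eq_of_nhds
    filter_upwards [eventually_differentiableAt hf, eventually_differentiableAt hg] with y h1 h2
    exact pd3_add i h1 h2
  simp only [helm, lap, h, Finset.sum_add_distrib]
  ring

lemma helm_const_mul (k c : ℝ) (hf : ContDiffAt ℝ ∞ f x) :
    helm k (fun y => c * f y) x = c * helm k f x := by
  have h : ∀ i, pd3 i (pd3 i (fun y => c * f y)) x = c * pd3 i (pd3 i f) x := by
    intro i
    rw [← pd3_const_mul i c (differentiableAt_pd3 i hf)]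
    refine (pd3_congr i ?_).eq_of_nhds
    filter_upwards [eventually_differentiableAt hf] with y h1
    exact pd3_const_mul i c h1
  simp only [helm, lap, h, ← Finset.mul_sum]
  ring

lemma helm_sub (k : ℝ) (hf : ContDiffAt ℝ ∞ f x) (hg : ContDiffAt ℝ ∞ g x) :
    helm k (fun y => f y - g y) x = helm k f x - helm k g x := by
  have := helm_add k hf (contDiffAt_const.mul hg : ContDiffAt ℝ ∞ (fun y => (-1 : ℝ) * g y) x)
  rw [helm_const_mul k _ hg] at this
  simpa [← sub_eq_add_neg] using this

lemma helm_comp_sub_const (k : ℝ) (f : E3 → ℝ) (a x : E3) :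
    helm k (fun y => f (y - a)) x = helm k f (x - a) := by
  have h : ∀ i, pd3 i (fun y => f (y - a)) = fun y => pd3 i f (y - a) := by
    intro i
    ext y
    exact pd3_comp_sub_const i f a y
  simp only [helm, lap, h, pd3_comp_sub_const]

lemma helm_eq_zero_of_notMem_tsupport (k : ℝ) (hx : x ∉ tsupport f) : helm k f x = 0 := by
  have h : ∀ i, pd3 i (0 : E3 → ℝ) = 0 := fun i => by
    ext y
    simp [pd3]
  rw [helm_congr k (notMem_tsupport_iff_eventuallyEq.1 hx)]
  simp [helm, lap, h]

lemma hasCompactSupport_helm (k : ℝ) (hf : HasCompactSupport f) : HasCompactSupport (helm k f) :=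
  HasCompactSupport.intro hf fun _ hx => helm_eq_zero_of_notMem_tsupport k hx

lemma integral_mul_pd3 (i : Fin 3) (hf : ContDiff ℝ ∞ f) (hg : ContDiff ℝ ∞ g)
    (hgs : HasCompactSupport g) : ∫ x, f x * pd3 i g x = - ∫ x, pd3 i f x * g x := by
  refine integral_mul_fderiv_eq_neg_fderiv_mul_of_integrable ?_ ?_ ?_
    (fun x _ => hf.differentiable (by simp) x) (fun x _ => hg.differentiable (by simp) x)
  · exact ((contDiff_pd3 i hf).continuous.mul hg.continuous).integrable_of_hasCompactSupport
      hgs.mul_left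
  · exact (hf.continuous.mul (contDiff_pd3 i hg).continuous).integrable_of_hasCompactSupport
      (hasCompactSupport_pd3 i hgs).mul_left
  · exact (hf.continuous.mul hg.continuous).integrable_of_hasCompactSupport hgs.mul_left

/-- Green's identity for the Helmholtz operator. -/
lemma integral_mul_helm (k : ℝ) (hf : ContDiff ℝ ∞ f) (hg : ContDiff ℝ ∞ g)
    (hgs : HasCompactSupport g) : ∫ x, f x * helm k g x = ∫ x, helm k f x * g x := by
  have hi : ∀ {a b : E3 → ℝ}, ContDiff ℝ ∞ a → ContDiff ℝ ∞ b → HasCompactSupport b →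
      Integrable (fun x => a x * b x) := fun ha hb hbs =>
    (ha.continuous.mul hb.continuous).integrable_of_hasCompactSupport hbs.mul_left
  have h : ∀ i, ∫ x, f x * pd3 i (pd3 i g) x = ∫ x, pd3 i (pd3 i f) x * g x := by
    intro i
    rw [integral_mul_pd3 i hf (contDiff_pd3 i hg) (hasCompactSupport_pd3 i hgs),
      integral_mul_pd3 i (contDiff_pd3 i hf) hg hgs, neg_neg]
  have e1 : ∀ x, f x * helm k g x = ∑ i, f x * pd3 i (pd3 i g) x + k ^ 2 * (f x * g x) := by
    intro x
    simp only [helm, lap, mul_add, Finset.mul_sum]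
    ring
  have e2 : ∀ x, helm k f x * g x = ∑ i, pd3 i (pd3 i f) x * g x + k ^ 2 * (f x * g x) := by
    intro x
    simp only [helm, lap, add_mul, Finset.sum_mul]
    ring
  simp only [e1, e2]
  rw [integral_add, integral_add, integral_finsetSum, integral_finsetSum]
  · simp only [h]
  · exact fun i _ => hi (contDiff_pd3 i (contDiff_pd3 i hf)) hg hgs
  · exact fun i _ => hi hf (contDiff_pd3 i (contDiff_pd3 i hg))
      (hasCompactSupport_pd3 i (hasCompactSupport_pd3 i hgs))
  · exact integrable_finsetSum _ fun i _ => hi (contDiff_pd3 i (contDiff_pd3 i hf)) hg hgs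
  · exact (hi hf hg hgs).const_mul _
  · exact integrable_finsetSum _ fun i _ => hi hf (contDiff_pd3 i (contDiff_pd3 i hg))
      (hasCompactSupport_pd3 i (hasCompactSupport_pd3 i hgs))
  · exact (hi hf hg hgs).const_mul _

end Helmholtz

section Radial

variable {N N₁ N₂ : ℝ → ℝ}

lemma pd3_radial (i : Fin 3) (h : ∀ q, 0 ≤ q → HasDerivAt N (N₁ q) q) (x : E3) :
    pd3 i (fun y => N (‖y‖ ^ 2)) x = 2 * x i * N₁ (‖x‖ ^ 2) := by
  have h1 : HasFDerivAt (fun y : E3 => ‖y‖ ^ 2) (2 • innerSL ℝ x) x :=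
    (hasStrictFDerivAt_norm_sq x).hasFDerivAt
  have h2 := (h (‖x‖ ^ 2) (by positivity)).comp_hasFDerivAt x h1
  have h3 : HasFDerivAt (fun y : E3 => N (‖y‖ ^ 2)) (N₁ (‖x‖ ^ 2) • 2 • innerSL ℝ x) x := h2
  simp [pd3, h3.fderiv, EuclideanSpace.inner_single_right]
  ring

lemma helm_radial (k : ℝ) (h : ∀ q, 0 ≤ q → HasDerivAt N (N₁ q) q)
    (h' : ∀ q, 0 ≤ q → HasDerivAt N₁ (N₂ q) q) (x : E3) :
    helm k (fun y => N (‖y‖ ^ 2)) x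
      = 4 * ‖x‖ ^ 2 * N₂ (‖x‖ ^ 2) + 6 * N₁ (‖x‖ ^ 2) + k ^ 2 * N (‖x‖ ^ 2) := by
  have h1 : ∀ i, pd3 i (fun y => N (‖y‖ ^ 2)) = fun x : E3 => 2 * x i * N₁ (‖x‖ ^ 2) :=
    fun i => funext fun x => pd3_radial i h x
  have h2 : ∀ i, pd3 i (fun x : E3 => 2 * x i * N₁ (‖x‖ ^ 2)) x
      = 2 * N₁ (‖x‖ ^ 2) + 4 * x i ^ 2 * N₂ (‖x‖ ^ 2) := by
    intro i
    have a1 : HasFDerivAt (fun y : E3 => 2 * y i)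
        ((2 : ℝ) • (EuclideanSpace.proj i : E3 →L[ℝ] ℝ)) x :=
      ((EuclideanSpace.proj i : E3 →L[ℝ] ℝ).hasFDerivAt).const_mul 2
    have a2 : HasFDerivAt (fun y : E3 => N₁ (‖y‖ ^ 2)) (N₂ (‖x‖ ^ 2) • 2 • innerSL ℝ x) x :=
      (h' (‖x‖ ^ 2) (by positivity)).comp_hasFDerivAt x
        (hasStrictFDerivAt_norm_sq x).hasFDerivAt
    have a3 : HasFDerivAt (fun x : E3 => 2 * x i * N₁ (‖x‖ ^ 2)) _ x := a1.mul a2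
    change fderiv ℝ (fun x : E3 => 2 * x i * N₁ (‖x‖ ^ 2)) x _ = _
    rw [a3.fderiv]
    simp [EuclideanSpace.inner_single_right]
    ring
  simp only [helm, lap, h1, h2, Fin.sum_univ_three]
  have h3 : ‖x‖ ^ 2 = x 0 ^ 2 + x 1 ^ 2 + x 2 ^ 2 := by
    rw [EuclideanSpace.real_norm_sq_eq, Fin.sum_univ_three]
  linear_combination (-4) * N₂ (‖x‖ ^ 2) * h3

lemma contDiff_radial (h : ∀ q, 0 ≤ q → ContDiffAt ℝ ∞ N q) :
    ContDiff ℝ ∞ (fun y : E3 => N (‖y‖ ^ 2)) := by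
  refine contDiff_iff_contDiffAt.2 fun x => ?_
  exact (h (‖x‖ ^ 2) (by positivity)).comp x (contDiff_norm_sq ℝ).contDiffAt

end Radial

section Profiles

/-- The profile `q ↦ u (√q) / √q`, so that `y ↦ profile u (‖y‖ ^ 2)` is `u (‖y‖) / ‖y‖`. -/
def profile (u : ℝ → ℝ) (q : ℝ) : ℝ := u √q / √q

/-- The derivative of `profile u`, where `u₁` is the derivative of `u`. -/
def profileDeriv (u u₁ : ℝ → ℝ) (q : ℝ) : ℝ := u₁ √q / (2 * √q ^ 2) - u √q / (2 * √q ^ 3)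

/-- The second derivative of `profile u`, where `u₁` is the derivative of `u` and
`u'' = - k² u`. -/
def profileDeriv₂ (k : ℝ) (u u₁ : ℝ → ℝ) (q : ℝ) : ℝ :=
  -k ^ 2 * u √q / (4 * √q ^ 3) - 3 * u₁ √q / (4 * √q ^ 4) + 3 * u √q / (4 * √q ^ 5)

variable {k q : ℝ} {u u₁ : ℝ → ℝ}

lemma hasDerivAt_profile (hu : ∀ r, HasDerivAt u (u₁ r) r) (hq : 0 < q) :
    HasDerivAt (profile u) (profileDeriv u u₁ q) q := by
  have hr : 0 < √q := Real.sqrt_pos.2 hq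
  have hs := Real.hasDerivAt_sqrt hq.ne'
  have h := ((hu √q).comp q hs).div hs hr.ne'
  refine h.congr_deriv ?_
  simp only [profileDeriv, Function.comp_apply]
  field_simp

lemma hasDerivAt_profileDeriv (hu : ∀ r, HasDerivAt u (u₁ r) r)
    (hu₁ : ∀ r, HasDerivAt u₁ (-k ^ 2 * u r) r) (hq : 0 < q) :
    HasDerivAt (profileDeriv u u₁) (profileDeriv₂ k u u₁ q) q := by
  have hr : 0 < √q := Real.sqrt_pos.2 hq
  have hs := Real.hasDerivAt_sqrt hq.ne'
  have hs2 : HasDerivAt (fun x => 2 * √x ^ 2) _ q := (hs.pow 2).const_mul 2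
  have hs3 : HasDerivAt (fun x => 2 * √x ^ 3) _ q := (hs.pow 3).const_mul 2
  have h := (((hu₁ √q).comp q hs).div hs2 (by positivity)).sub
    (((hu √q).comp q hs).div hs3 (by positivity))
  refine h.congr_deriv ?_
  simp only [profileDeriv₂, Function.comp_apply]
  field_simp
  ring

lemma profile_ode (hq : 0 < q) :
    4 * q * profileDeriv₂ k u u₁ q + 6 * profileDeriv u u₁ q + k ^ 2 * profile u q = 0 := by
  have hr : 0 < √q := Real.sqrt_pos.2 hq
  have h : 4 * q = 4 * √q ^ 2 := by rw [Real.sq_sqrt hq.le]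
  rw [h]
  simp only [profileDeriv₂, profileDeriv, profile]
  field_simp
  ring

lemma contDiffAt_profile (hu : ContDiff ℝ ∞ u) (hq : 0 < q) : ContDiffAt ℝ ∞ (profile u) q :=
  (hu.contDiffAt.comp q (Real.contDiffAt_sqrt hq.ne')).div (Real.contDiffAt_sqrt hq.ne')
    (Real.sqrt_pos.2 hq).ne'

lemma helm_radial_of_eventuallyEq {N : ℝ → ℝ} {c : ℝ} {x : E3}
    (hu : ∀ r, HasDerivAt u (u₁ r) r) (hu₁ : ∀ r, HasDerivAt u₁ (-k ^ 2 * u r) r)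
    (hN : ContDiff ℝ ∞ N) (hx : x ≠ 0)
    (h : N =ᶠ[𝓝 (‖x‖ ^ 2)] fun q => c * profile u q) :
    helm k (fun y => N (‖y‖ ^ 2)) x = 0 := by
  have hq : 0 < ‖x‖ ^ 2 := by positivity
  have hN1 : ContDiff ℝ ∞ (deriv N) := (contDiff_infty_iff_deriv.1 hN).2
  have e1 : deriv N =ᶠ[𝓝 (‖x‖ ^ 2)] fun q => c * profileDeriv u u₁ q := by
    filter_upwards [h.eventually_nhds, lt_mem_nhds hq] with q h1 h2
    rw [EventuallyEq.deriv_eq h1]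
    exact ((hasDerivAt_profile hu h2).const_mul c).deriv
  have e2 : deriv (deriv N) (‖x‖ ^ 2) = c * profileDeriv₂ k u u₁ (‖x‖ ^ 2) := by
    rw [e1.deriv_eq]
    exact ((hasDerivAt_profileDeriv hu hu₁ hq).const_mul c).deriv
  rw [helm_radial k (N₁ := deriv N) (N₂ := deriv (deriv N))
    (fun q _ => (hN.differentiable (by simp) q).hasDerivAt)
    (fun q _ => (hN1.differentiable (by simp) q).hasDerivAt), e2, e1.eq_of_nhds, h.eq_of_nhds]
  linear_combination c * profile_ode (k := k) (u := u) (u₁ := u₁) hq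

lemma hasDerivAt_cos_mul (k r : ℝ) :
    HasDerivAt (fun r => Real.cos (k * r)) (-k * Real.sin (k * r)) r := by
  refine ((Real.hasDerivAt_cos (k * r)).comp r ((hasDerivAt_id r).const_mul k)).congr_deriv ?_
  simp
  ring

lemma hasDerivAt_sin_mul (k r : ℝ) :
    HasDerivAt (fun r => Real.sin (k * r)) (k * Real.cos (k * r)) r := by
  refine ((Real.hasDerivAt_sin (k * r)).comp r ((hasDerivAt_id r).const_mul k)).congr_deriv ?_
  simp
  ring

lemma hasDerivAt_neg_mul_sin_mul (k r : ℝ) :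
    HasDerivAt (fun r => -k * Real.sin (k * r)) (-k ^ 2 * Real.cos (k * r)) r :=
  ((hasDerivAt_sin_mul k r).const_mul (-k)).congr_deriv (by ring)

lemma hasDerivAt_mul_cos_mul (k r : ℝ) :
    HasDerivAt (fun r => k * Real.cos (k * r)) (-k ^ 2 * Real.sin (k * r)) r :=
  ((hasDerivAt_cos_mul k r).const_mul k).congr_deriv (by ring)

end Profiles

section RegularKernel

/-- The entire function of `q` that agrees with `sin (√q) / √q` for `q > 0`. -/
def sincSqrt (q : ℝ) : ℝ :=
  FormalMultilinearSeries.ofScalarsSum (fun n : ℕ => (-1 : ℝ) ^ n / ((2 * n + 1).factorial : ℝ)) q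

lemma contDiff_sincSqrt : ContDiff ℝ ∞ sincSqrt := by
  set c : ℕ → ℝ := fun n => (-1 : ℝ) ^ n / ((2 * n + 1).factorial : ℝ) with hc
  have hrad : (FormalMultilinearSeries.ofScalars ℝ c).radius = ⊤ := by
    refine FormalMultilinearSeries.ofScalars_radius_eq_top_of_tendsto ℝ c
      (Eventually.of_forall fun n => by simp [hc, Nat.factorial_ne_zero]) ?_
    have h1 : ∀ n : ℕ, ‖c n.succ‖ / ‖c n‖ = 1 / ((2 * n + 3 : ℝ) * (2 * n + 2)) := by
      intro n
      have h2 : ((2 * n.succ + 1).factorial : ℝ)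
          = (2 * n + 3) * (2 * n + 2) * ((2 * n + 1).factorial : ℝ) := by
        rw [show 2 * n.succ + 1 = 2 * n + 1 + 1 + 1 by omega, Nat.factorial_succ,
          Nat.factorial_succ]
        push_cast
        ring
      have h3 : ((2 * n + 1).factorial : ℝ) ≠ 0 := by positivity
      simp only [hc, norm_div, norm_pow, norm_neg, norm_one, one_pow, h2, norm_mul]
      rw [Real.norm_of_nonneg (by positivity : (0 : ℝ) ≤ 2 * n + 3),
        Real.norm_of_nonneg (by positivity : (0 : ℝ) ≤ 2 * n + 2),
        Real.norm_of_nonneg (by positivity : (0 : ℝ) ≤ ((2 * n + 1).factorial : ℝ))]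
      field_simp
    simp only [h1]
    refine squeeze_zero (fun n => by positivity) (fun n => ?_)
      tendsto_one_div_add_atTop_nhds_zero_nat
    apply one_div_le_one_div_of_le (by positivity)
    have : (0 : ℝ) ≤ n := n.cast_nonneg
    nlinarith
  have hps := (FormalMultilinearSeries.ofScalars ℝ c).hasFPowerSeriesOnBall (by simp [hrad])
  rw [hrad] at hps
  refine contDiff_iff_contDiffAt.2 fun q => ?_
  exact (hps.analyticAt_of_mem (by simp)).contDiffAt

lemma sincSqrt_sq (r : ℝ) : sincSqrt (r ^ 2) = Real.sinc r := by
  rw [sincSqrt, FormalMultilinearSeries.ofScalars_sum_eq]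
  rcases eq_or_ne r 0 with rfl | hr
  · rw [tsum_eq_single 0]
    · simp
    · intro n hn
      simp [hn]
  · rw [Real.sinc_of_ne_zero hr, ← (Real.hasSum_sin r).tsum_eq, ← tsum_div_const]
    refine tsum_congr fun n => ?_
    rw [smul_eq_mul, ← pow_mul, pow_succ]
    field_simp

/-- The regular radial solution `sin (k‖x‖) / (k‖x‖)` of the Helmholtz equation. -/
def regK (k : ℝ) (x : E3) : ℝ := sincSqrt (k ^ 2 * ‖x‖ ^ 2)

lemma regK_eq_sinc (k : ℝ) (x : E3) : regK k x = Real.sinc (k * ‖x‖) := by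
  rw [regK, ← mul_pow, sincSqrt_sq]

lemma contDiff_regK (k : ℝ) : ContDiff ℝ ∞ (regK k) :=
  contDiff_radial (N := fun q => sincSqrt (k ^ 2 * q)) fun _ _ =>
    (contDiff_sincSqrt.comp (contDiff_const.mul contDiff_id)).contDiffAt

lemma helm_regK {k : ℝ} (hk : 0 < k) (x : E3) : helm k (regK k) x = 0 := by
  have hN : ContDiff ℝ ∞ fun q : ℝ => sincSqrt (k ^ 2 * q) :=
    contDiff_sincSqrt.comp (contDiff_const.mul contDiff_id)
  have h0 : ∀ x : E3, x ≠ 0 → helm k (regK k) x = 0 := by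
    intro x hx
    refine helm_radial_of_eventuallyEq (c := k⁻¹) (N := fun q => sincSqrt (k ^ 2 * q))
      (hasDerivAt_sin_mul k) (hasDerivAt_mul_cos_mul k) hN hx ?_
    have hq : 0 < ‖x‖ ^ 2 := by positivity
    filter_upwards [lt_mem_nhds hq] with q h2
    have hr : 0 < √q := Real.sqrt_pos.2 h2
    have : k ^ 2 * q = (k * √q) ^ 2 := by rw [mul_pow, Real.sq_sqrt h2.le]
    rw [this, sincSqrt_sq, Real.sinc_of_ne_zero (by positivity), profile]
    field_simp
  have hc : IsClosed {x : E3 | helm k (regK k) x = 0} :=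
    isClosed_eq (contDiff_helm k (contDiff_regK k)).continuous continuous_const
  have hd : Dense ({0}ᶜ : Set E3) := dense_compl_singleton 0
  have := hc.closure_subset_iff.2 (fun x (hx : x ∈ ({0}ᶜ : Set E3)) => h0 x hx)
  exact this (hd x)

lemma abs_regK_le {k : ℝ} (hk : 0 < k) (x : E3) : |regK k x| ≤ (1 + k⁻¹) / (1 + ‖x‖) := by
  rw [regK_eq_sinc, le_div_iff₀ (by positivity), mul_add, mul_one]
  refine add_le_add (Real.abs_sinc_le_one _) ?_
  rcases eq_or_ne ‖x‖ 0 with h | h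
  · rw [h, mul_zero]
    positivity
  · have hx : 0 < ‖x‖ := lt_of_le_of_ne (norm_nonneg x) h.symm
    rw [Real.sinc_of_ne_zero (by positivity), abs_div, abs_of_pos (mul_pos hk hx)]
    have := Real.abs_sin_le_one (k * ‖x‖)
    calc |Real.sin (k * ‖x‖)| / (k * ‖x‖) * ‖x‖ = |Real.sin (k * ‖x‖)| * k⁻¹ := by field_simp
      _ ≤ 1 * k⁻¹ := by gcongr
      _ = k⁻¹ := one_mul _

end RegularKernel

section SingularKernel

/-- A smooth radial function that agrees with `cos (k‖x‖) / ‖x‖` where `‖x‖² ≥ a`. -/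
def cutK (k a : ℝ) (x : E3) : ℝ :=
  Real.smoothTransition (2 * ‖x‖ ^ 2 / a - 1) * profile (fun r => Real.cos (k * r)) (‖x‖ ^ 2)

variable {k a : ℝ} {x : E3}

lemma contDiff_cutK_profile (k : ℝ) (ha : 0 < a) : ContDiff ℝ ∞ fun q : ℝ =>
    Real.smoothTransition (2 * q / a - 1) * profile (fun r => Real.cos (k * r)) q := by
  refine contDiff_iff_contDiffAt.2 fun q => ?_
  rcases lt_or_ge 0 q with hq | hq
  · refine ContDiffAt.mul ?_ (contDiffAt_profile (by fun_prop) hq)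
    exact (Real.smoothTransition.contDiff.comp
      (((contDiff_const.mul contDiff_id).div_const a).sub contDiff_const)).contDiffAt
  · refine (contDiffAt_const (c := (0 : ℝ))).congr_of_eventuallyEq ?_
    filter_upwards [gt_mem_nhds (show q < a / 2 by linarith)] with p hp
    rw [Real.smoothTransition.zero_of_nonpos, zero_mul]
    rw [sub_nonpos, div_le_one ha]
    linarith

lemma contDiff_cutK (k : ℝ) (ha : 0 < a) : ContDiff ℝ ∞ (cutK k a) :=
  contDiff_radial fun _ _ => (contDiff_cutK_profile k ha).contDiffAt

lemma cutK_eq (k : ℝ) (ha : 0 < a) (hx : a ≤ ‖x‖ ^ 2) :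
    cutK k a x = Real.cos (k * ‖x‖) / ‖x‖ := by
  rw [cutK, Real.smoothTransition.one_of_one_le, one_mul, profile, Real.sqrt_sq (norm_nonneg x)]
  rw [le_sub_iff_add_le, le_div_iff₀ ha]
  linarith

lemma helm_cutK (ha : 0 < a) (hx : a < ‖x‖ ^ 2) : helm k (cutK k a) x = 0 := by
  refine helm_radial_of_eventuallyEq (c := 1)
    (N := fun q => Real.smoothTransition (2 * q / a - 1) * profile (fun r => Real.cos (k * r)) q)
    (hasDerivAt_cos_mul k) (hasDerivAt_neg_mul_sin_mul k) (contDiff_cutK_profile k ha) ?_ ?_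
  · rintro rfl
    simp at hx
    linarith
  · filter_upwards [lt_mem_nhds hx] with q hq
    rw [Real.smoothTransition.one_of_one_le]
    rw [le_sub_iff_add_le, le_div_iff₀ ha]
    linarith

/-- A smooth regularization of `cos (k‖x‖) / ‖x‖`. -/
def approxK (k ε : ℝ) (x : E3) : ℝ := profile (fun r => Real.cos (k * r)) (‖x‖ ^ 2 + ε ^ 2)

lemma contDiff_approxK (k : ℝ) {ε : ℝ} (hε : 0 < ε) : ContDiff ℝ ∞ (approxK k ε) := by
  refine contDiff_radial (N := fun q => profile (fun r => Real.cos (k * r)) (q + ε ^ 2))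
    fun q hq => ?_
  exact (contDiffAt_profile (u := fun r => Real.cos (k * r)) (by fun_prop)
    (by positivity : 0 < q + ε ^ 2)).comp q (contDiffAt_id.add contDiffAt_const)

lemma helm_approxK (k : ℝ) {ε : ℝ} (hε : 0 < ε) (x : E3) :
    helm k (approxK k ε) x = -4 * ε ^ 2 * profileDeriv₂ k (fun r => Real.cos (k * r))
      (fun r => -k * Real.sin (k * r)) (‖x‖ ^ 2 + ε ^ 2) := by
  have hp : ∀ q : ℝ, 0 ≤ q → 0 < q + ε ^ 2 := fun q hq => by positivity
  have h := helm_radial k (N := fun q => profile (fun r => Real.cos (k * r)) (q + ε ^ 2))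
    (fun q hq => HasDerivAt.comp_add_const q (ε ^ 2)
      (hasDerivAt_profile (hasDerivAt_cos_mul k) (hp q hq)))
    (fun q hq => HasDerivAt.comp_add_const q (ε ^ 2) (hasDerivAt_profileDeriv
      (hasDerivAt_cos_mul k) (hasDerivAt_neg_mul_sin_mul k) (hp q hq))) x
  have h2 := profile_ode (k := k) (u := fun r => Real.cos (k * r))
    (u₁ := fun r => -k * Real.sin (k * r)) (hp (‖x‖ ^ 2) (by positivity))
  unfold approxK
  rw [h]
  linear_combination h2

end SingularKernel

section Representation

/-- The weight `(1 + ‖z‖²)^(-5/2)`. -/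
def weight (z : E3) : ℝ := (√(1 + ‖z‖ ^ 2) ^ 5)⁻¹

lemma weight_pos (z : E3) : 0 < weight z := by
  unfold weight
  positivity

lemma continuous_weight : Continuous weight := by
  unfold weight
  refine Continuous.inv₀ (by fun_prop) fun z => ?_
  positivity

lemma integrable_weight : Integrable weight := by
  have h := integrable_rpow_neg_one_add_norm_sq (E := E3) (μ := volume) (r := 5)
    (by simp; norm_num)
  refine h.congr (Eventually.of_forall fun z => ?_)
  have h0 : (0 : ℝ) ≤ 1 + ‖z‖ ^ 2 := by positivity
  simp only [weight]
  rw [Real.sqrt_eq_rpow, ← Real.rpow_natCast _ 5, ← Real.rpow_mul h0, ← Real.rpow_neg h0]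
  norm_num

/-- The normalizing constant of the fundamental solution (in fact equal to `4π`). -/
def fundConst : ℝ := 3 * ∫ z, weight z

lemma fundConst_pos : 0 < fundConst := by
  refine mul_pos (by norm_num) ?_
  exact integral_pos_of_integrable_nonneg_nonzero (x := 0) continuous_weight integrable_weight
    (fun z => (weight_pos z).le) (weight_pos 0).ne'

variable {k : ℝ} {h : E3 → ℝ} {x : E3}

lemma neg_four_mul_profileDeriv₂_cos (k : ℝ) {ε s : ℝ} (hε : 0 < ε) (hs : 0 < s) :
    ε ^ 3 * (-4 * ε ^ 2 * profileDeriv₂ k (fun r => Real.cos (k * r))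
      (fun r => -k * Real.sin (k * r)) ((ε * s) ^ 2))
      = (k ^ 2 * (ε * s) ^ 2 * Real.cos (k * (ε * s)) - 3 * k * (ε * s) * Real.sin (k * (ε * s))
          - 3 * Real.cos (k * (ε * s))) * (s ^ 5)⁻¹ := by
  have h1 : √((ε * s) ^ 2) = ε * s := Real.sqrt_sq (by positivity)
  simp only [profileDeriv₂, h1]
  field_simp
  ring

lemma integral_helm_approxK (k : ℝ) {ε : ℝ} (hε : 0 < ε) (h : E3 → ℝ) (x : E3) :
    ∫ y, helm k (approxK k ε) (y - x) * h y
      = ∫ z, (k ^ 2 * (ε * √(1 + ‖z‖ ^ 2)) ^ 2 * Real.cos (k * (ε * √(1 + ‖z‖ ^ 2)))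
          - 3 * k * (ε * √(1 + ‖z‖ ^ 2)) * Real.sin (k * (ε * √(1 + ‖z‖ ^ 2)))
          - 3 * Real.cos (k * (ε * √(1 + ‖z‖ ^ 2)))) * weight z * h (x + ε • z) := by
  have e1 : ∫ y, helm k (approxK k ε) (y - x) * h y
      = ∫ y, helm k (approxK k ε) y * h (x + y) := by
    rw [← integral_add_left_eq_self _ x]
    simp
  have e2 := Measure.integral_comp_smul (volume : Measure E3)
    (fun y => helm k (approxK k ε) y * h (x + y)) ε
  have h3 : |(ε ^ Module.finrank ℝ E3)⁻¹| = (ε ^ 3)⁻¹ := by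
    rw [abs_of_pos (by positivity)]
    simp
  rw [h3, smul_eq_mul, eq_comm, inv_mul_eq_iff_eq_mul₀ (by positivity)] at e2
  rw [e1, e2, ← integral_const_mul]
  refine integral_congr_ae (Eventually.of_forall fun z => ?_)
  have hs : 0 < √(1 + ‖z‖ ^ 2) := by positivity
  have e3 : ‖ε • z‖ ^ 2 + ε ^ 2 = (ε * √(1 + ‖z‖ ^ 2)) ^ 2 := by
    rw [mul_pow, Real.sq_sqrt (by positivity), norm_smul, Real.norm_of_nonneg hε.le]
    ring
  simp only [weight]
  rw [← neg_four_mul_profileDeriv₂_cos k hε hs, helm_approxK k hε, e3, ← mul_assoc (ε ^ 3)]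

lemma tendsto_integral_helm_approxK (k : ℝ) (hh : Continuous h) (hs : HasCompactSupport h)
    (x : E3) : Tendsto (fun ε => ∫ y, helm k (approxK k ε) (y - x) * h y) (𝓝[>] 0)
      (𝓝 (-fundConst * h x)) := by
  obtain ⟨M, hM⟩ := hs.exists_bound_of_continuous hh
  obtain ⟨R, hR⟩ := hs.isCompact.isBounded.subset_closedBall x
  set B : ℝ := 1 + |R| with hB
  have hlim : -fundConst * h x = ∫ z, -3 * weight z * h x := by
    rw [integral_mul_const, integral_const_mul, fundConst]
    ring
  rw [hlim]
  have hcongr : (fun ε => ∫ z, (k ^ 2 * (ε * √(1 + ‖z‖ ^ 2)) ^ 2 *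
          Real.cos (k * (ε * √(1 + ‖z‖ ^ 2)))
          - 3 * k * (ε * √(1 + ‖z‖ ^ 2)) * Real.sin (k * (ε * √(1 + ‖z‖ ^ 2)))
          - 3 * Real.cos (k * (ε * √(1 + ‖z‖ ^ 2)))) * weight z * h (x + ε • z))
      =ᶠ[𝓝[>] 0] fun ε => ∫ y, helm k (approxK k ε) (y - x) * h y := by
    filter_upwards [self_mem_nhdsWithin] with ε hε
    exact (integral_helm_approxK k hε h x).symm
  refine Tendsto.congr' hcongr ?_
  refine tendsto_integral_filter_of_dominated_convergence
    (fun z => (k ^ 2 * B ^ 2 + 3 * |k| * B + 3) * M * weight z) ?_ ?_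
    (integrable_weight.const_mul _) ?_
  · refine Eventually.of_forall fun ε => Continuous.aestronglyMeasurable ?_
    have := continuous_weight
    fun_prop
  · have : Ioo (0 : ℝ) 1 ∈ 𝓝[>] (0 : ℝ) := Ioo_mem_nhdsGT one_pos
    filter_upwards [this] with ε hε
    refine Eventually.of_forall fun z => ?_
    have hs0 : 0 < √(1 + ‖z‖ ^ 2) := by positivity
    have hM0 : 0 ≤ M := (norm_nonneg _).trans (hM x)
    by_cases hz : h (x + ε • z) = 0
    · rw [hz, mul_zero, norm_zero]
      have := (weight_pos z).le
      positivity
    have hz' := hR (subset_tsupport h (Function.mem_support.2 hz))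
    rw [mem_closedBall, dist_eq_norm, add_sub_cancel_left, norm_smul,
      Real.norm_of_nonneg hε.1.le] at hz'
    have hsz : √(1 + ‖z‖ ^ 2) ≤ 1 + ‖z‖ := by
      rw [Real.sqrt_le_left (by positivity)]
      nlinarith [norm_nonneg z]
    set t := ε * √(1 + ‖z‖ ^ 2) with ht
    have ht0 : 0 ≤ t := mul_nonneg hε.1.le hs0.le
    have htB : t ≤ B := by
      calc t ≤ ε * (1 + ‖z‖) := mul_le_mul_of_nonneg_left hsz hε.1.le
        _ = ε + ε * ‖z‖ := by ring
        _ ≤ 1 + |R| := add_le_add hε.2.le (hz'.trans (le_abs_self R))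
    rw [norm_mul, norm_mul, Real.norm_of_nonneg (weight_pos z).le]
    have hA : ‖k ^ 2 * t ^ 2 * Real.cos (k * t) - 3 * k * t * Real.sin (k * t)
        - 3 * Real.cos (k * t)‖ ≤ k ^ 2 * B ^ 2 + 3 * |k| * B + 3 := by
      have hc := Real.abs_cos_le_one (k * t)
      have hs := Real.abs_sin_le_one (k * t)
      refine (norm_sub_le _ _).trans (add_le_add ((norm_sub_le _ _).trans (add_le_add ?_ ?_)) ?_)
      · rw [Real.norm_eq_abs, abs_mul, abs_of_nonneg (by positivity : 0 ≤ k ^ 2 * t ^ 2)]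
        calc k ^ 2 * t ^ 2 * |Real.cos (k * t)| ≤ k ^ 2 * B ^ 2 * 1 := by gcongr
          _ = _ := mul_one _
      · rw [Real.norm_eq_abs, abs_mul, abs_mul, abs_mul, abs_of_nonneg ht0,
          abs_of_pos (by norm_num : (0 : ℝ) < 3)]
        calc 3 * |k| * t * |Real.sin (k * t)| ≤ 3 * |k| * B * 1 := by gcongr
          _ = _ := mul_one _
      · rw [Real.norm_eq_abs, abs_mul, abs_of_pos (by norm_num : (0 : ℝ) < 3)]
        linarith
    have hB0 : 0 ≤ B := ht0.trans htB
    have := weight_pos z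
    calc _ ≤ (k ^ 2 * B ^ 2 + 3 * |k| * B + 3) * weight z * M := by
          gcongr
          exact hM _
      _ = _ := by ring
  · refine Eventually.of_forall fun z => ?_
    have hcont : Continuous fun ε : ℝ => (k ^ 2 * (ε * √(1 + ‖z‖ ^ 2)) ^ 2 *
          Real.cos (k * (ε * √(1 + ‖z‖ ^ 2)))
          - 3 * k * (ε * √(1 + ‖z‖ ^ 2)) * Real.sin (k * (ε * √(1 + ‖z‖ ^ 2)))
          - 3 * Real.cos (k * (ε * √(1 + ‖z‖ ^ 2)))) * weight z * h (x + ε • z) := by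
      fun_prop
    have := (hcont.tendsto 0).mono_left (nhdsWithin_le_nhds (s := Ioi 0))
    simpa using this

lemma tendsto_integral_approxK (k : ℝ) {m : E3 → ℝ} {ρ : ℝ} (hρ : 0 < ρ) (hm : Continuous m)
    (hs : HasCompactSupport m) (hx : ∀ y ∈ ball x ρ, m y = 0) :
    Tendsto (fun ε => ∫ y, approxK k ε (y - x) * m y) (𝓝[>] 0)
      (𝓝 (∫ y, cutK k (ρ ^ 2) (y - x) * m y)) := by
  refine tendsto_integral_filter_of_dominated_convergence (fun y => ρ⁻¹ * |m y|) ?_ ?_ ?_ ?_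
  · filter_upwards [self_mem_nhdsWithin] with ε hε
    have := (contDiff_approxK k hε).continuous
    exact Continuous.aestronglyMeasurable (by fun_prop)
  · filter_upwards [self_mem_nhdsWithin] with ε hε
    refine Eventually.of_forall fun y => ?_
    rw [norm_mul, Real.norm_eq_abs (m y)]
    by_cases hy : y ∈ ball x ρ
    · simp [hx y hy]
    refine mul_le_mul_of_nonneg_right ?_ (abs_nonneg _)
    rw [mem_ball, not_lt, dist_eq_norm] at hy
    have h1 : ρ ≤ √(‖y - x‖ ^ 2 + ε ^ 2) := by
      refine Real.le_sqrt_of_sq_le ?_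
      nlinarith [sq_nonneg ε]
    rw [approxK, profile, Real.norm_eq_abs, abs_div, abs_of_nonneg (Real.sqrt_nonneg _),
      div_eq_mul_inv]
    calc _ ≤ 1 * ρ⁻¹ := by
          gcongr
          exact Real.abs_cos_le_one _
      _ = _ := one_mul _
  · exact (hm.abs.integrable_of_hasCompactSupport (hs.comp_left (g := abs) abs_zero)).const_mul _
  · refine Eventually.of_forall fun y => ?_
    by_cases hy : y ∈ ball x ρ
    · simp [hx y hy]
    rw [mem_ball, not_lt, dist_eq_norm] at hy
    have hpos : 0 < ‖y - x‖ := hρ.trans_le hy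
    refine Tendsto.mul_const _ ?_
    rw [cutK_eq k (by positivity) (by gcongr)]
    have hc : ContinuousAt (fun ε : ℝ => approxK k ε (y - x)) 0 := by
      unfold approxK profile
      refine ContinuousAt.div (by fun_prop) (by fun_prop) ?_
      simp [hpos.ne']
    have := hc.tendsto.mono_left (nhdsWithin_le_nhds (s := Ioi 0))
    simpa [approxK, profile] using this

/-- Representation of a test function through the fundamental solution, at points near which it
satisfies the Helmholtz equation. -/
lemma integral_cutK_mul_helm (k : ℝ) {ρ : ℝ} (hρ : 0 < ρ) (hh : ContDiff ℝ ∞ h)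
    (hs : HasCompactSupport h) (hx : ∀ y ∈ ball x ρ, helm k h y = 0) :
    ∫ y, cutK k (ρ ^ 2) (y - x) * helm k h y = -fundConst * h x := by
  refine tendsto_nhds_unique (tendsto_integral_approxK k hρ (contDiff_helm k hh).continuous
    (hasCompactSupport_helm k hs) hx) ?_
  refine (tendsto_integral_helm_approxK k hh.continuous hs x).congr' ?_
  filter_upwards [self_mem_nhdsWithin] with ε hε
  have h1 : ContDiff ℝ ∞ fun y => approxK k ε (y - x) :=
    (contDiff_approxK k hε).comp (contDiff_id.sub contDiff_const)
  rw [integral_mul_helm k h1 hh hs]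
  simp only [helm_comp_sub_const]

/-- The reproducing kernel for solutions of the Helmholtz equation on balls of radius `ρ`. -/
def reproK (k ρ : ℝ) (x : E3) : ℝ := -fundConst⁻¹ * helm k (cutK k (ρ ^ 2)) x

lemma contDiff_reproK (k : ℝ) {ρ : ℝ} (hρ : 0 < ρ) : ContDiff ℝ ∞ (reproK k ρ) :=
  contDiff_const.mul (contDiff_helm k (contDiff_cutK k (by positivity)))

lemma hasCompactSupport_reproK (k : ℝ) {ρ : ℝ} (hρ : 0 < ρ) : HasCompactSupport (reproK k ρ) := by
  refine HasCompactSupport.intro (isCompact_closedBall 0 ρ) fun x hx => ?_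
  rw [mem_closedBall, dist_zero_right, not_le] at hx
  rw [reproK, helm_cutK (by positivity) (by gcongr), mul_zero]

lemma eq_integral_reproK (k : ℝ) {ρ : ℝ} (hρ : 0 < ρ) (hh : ContDiff ℝ ∞ h)
    (hs : HasCompactSupport h) (hx : ∀ y ∈ ball x ρ, helm k h y = 0) :
    h x = ∫ y, h y * reproK k ρ (y - x) := by
  have h1 := integral_cutK_mul_helm k hρ hh hs hx
  have hcut : ContDiff ℝ ∞ fun y => cutK k (ρ ^ 2) (y - x) :=
    (contDiff_cutK k (by positivity)).comp (contDiff_id.sub contDiff_const)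
  rw [integral_mul_helm k hcut hh hs] at h1
  have h2 : ∀ y, h y * reproK k ρ (y - x)
      = -fundConst⁻¹ * (helm k (fun y => cutK k (ρ ^ 2) (y - x)) y * h y) := by
    intro y
    rw [helm_comp_sub_const, reproK]
    ring
  simp only [h2]
  have h3 := fundConst_pos.ne'
  rw [integral_const_mul, h1]
  field_simp

end Representation

section InteriorEstimate

/-- Truncation of a locally smooth function to a test function, unchanged near a compact set. -/
lemma exists_truncation {A U : Set E3} (hA : IsCompact A) (hU : IsOpen U) (hAU : A ⊆ U)
    {f : E3 → ℝ} (hf : ∀ x ∈ U, ContDiffAt ℝ ∞ f x) :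
    ∃ h : E3 → ℝ, ContDiff ℝ ∞ h ∧ HasCompactSupport h ∧ tsupport h ⊆ U ∧
      (∀ x ∈ A, h =ᶠ[𝓝 x] f) ∧ ∀ x, |h x| ≤ |f x| := by
  obtain ⟨B, hB, hAB, hBU⟩ := exists_compact_between hA hU hAU
  obtain ⟨η, h1, h0, h01⟩ := exists_contMDiffMap_one_nhds_of_subset_interior (n := (⊤ : ℕ∞))
    𝓘(ℝ, E3)
    hA.isClosed hAB
  have hη : ContDiff ℝ ∞ (η : E3 → ℝ) := η.contMDiff.contDiff
  have hsupp : tsupport (fun x => η x * f x) ⊆ B := by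
    refine closure_minimal (fun x hx => ?_) hB.isClosed
    by_contra hxB
    exact hx (by simp [h0 x hxB])
  refine ⟨fun x => η x * f x, ?_, ?_, hsupp.trans hBU, ?_, ?_⟩
  · refine contDiff_iff_contDiffAt.2 fun x => ?_
    by_cases hx : x ∈ U
    · exact hη.contDiffAt.mul (hf x hx)
    · have : x ∉ tsupport (fun x => η x * f x) := fun h => hx (hBU (hsupp h))
      exact contDiffAt_const.congr_of_eventuallyEq (notMem_tsupport_iff_eventuallyEq.1 this)
  · exact hB.of_isClosed_subset (isClosed_tsupport _) hsupp
  · intro x hx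
    filter_upwards [eventually_nhdsSet_iff_forall.1 h1 x hx] with y hy
    simp [hy]
  · intro x
    rw [abs_mul, abs_of_nonneg (h01 x).1]
    exact mul_le_of_le_one_left (abs_nonneg _) (h01 x).2

/-- Convolution of a scalar function with a vector valued kernel. -/
def conv {F : Type} [NormedAddCommGroup F] [NormedSpace ℝ F] (h : E3 → ℝ) (κ : E3 → F)
    (x : E3) : F := ∫ y, h y • κ (x - y)

lemma hasFDerivAt_conv {F : Type} [NormedAddCommGroup F] [NormedSpace ℝ F] {h : E3 → ℝ}
    (hh : Integrable h) {κ : E3 → F} (hκ : ContDiff ℝ ∞ κ) (hs : HasCompactSupport κ) (x : E3) :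
    HasFDerivAt (conv h κ) (conv h (fderiv ℝ κ) x) x := by
  have hc' : Continuous (fderiv ℝ κ) := (hκ.fderiv_right (m := ∞) (by simp)).continuous
  obtain ⟨M, hM⟩ := hs.exists_bound_of_continuous hκ.continuous
  obtain ⟨M', hM'⟩ := (hs.fderiv ℝ).exists_bound_of_continuous hc'
  have hmeas : ∀ {G : Type} [NormedAddCommGroup G] [NormedSpace ℝ G] {θ : E3 → G} (z : E3),
      Continuous θ → AEStronglyMeasurable (fun y => h y • θ (z - y)) volume := by
    intro G _ _ θ z hθ
    have : Continuous fun y => θ (z - y) := by fun_prop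
    exact hh.aestronglyMeasurable.smul this.aestronglyMeasurable
  refine hasFDerivAt_integral_of_dominated_of_fderiv_le (bound := fun y => ‖h y‖ * M')
    (F' := fun z y => h y • fderiv ℝ κ (z - y)) univ_mem
    (Eventually.of_forall fun z => hmeas z hκ.continuous) ?_ (hmeas x hc') ?_
    (hh.norm.mul_const _) ?_
  · refine (hh.norm.mul_const M).mono' (hmeas x hκ.continuous) (Eventually.of_forall fun y => ?_)
    rw [norm_smul]
    exact mul_le_mul_of_nonneg_left (hM _) (norm_nonneg _)
  · refine Eventually.of_forall fun y z _ => ?_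
    rw [norm_smul]
    exact mul_le_mul_of_nonneg_left (hM' _) (norm_nonneg _)
  · refine Eventually.of_forall fun y z _ => ?_
    have h1 : HasFDerivAt κ (fderiv ℝ κ (z - y)) (z - y) :=
      (hκ.differentiable (by simp) _).hasFDerivAt
    exact ((hasFDerivAt_comp_sub (f := κ) y).2 h1).const_smul (h y)

lemma norm_iteratedFDeriv_conv_le {h : E3 → ℝ} (hh : Integrable h) (n : ℕ) :
    ∀ {F : Type} [NormedAddCommGroup F] [NormedSpace ℝ F] {κ : E3 → F} {M : ℝ},
    ContDiff ℝ ∞ κ → HasCompactSupport κ → (∀ z, ‖iteratedFDeriv ℝ n κ z‖ ≤ M) → ∀ x,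
    ‖iteratedFDeriv ℝ n (conv h κ) x‖ ≤ M * ∫ y, |h y| := by
  induction n with
  | zero =>
    intro F _ _ κ M hκ hs hM x
    simp only [norm_iteratedFDeriv_zero] at hM ⊢
    rw [mul_comm, ← integral_mul_const]
    refine norm_integral_le_of_norm_le (hh.norm.mul_const M) (Eventually.of_forall fun y => ?_)
    rw [norm_smul]
    exact mul_le_mul_of_nonneg_left (hM _) (norm_nonneg _)
  | succ n ih =>
    intro F _ _ κ M hκ hs hM x
    have h1 : fderiv ℝ (conv h κ) = conv h (fderiv ℝ κ) :=
      funext fun z => (hasFDerivAt_conv hh hκ hs z).fderiv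
    rw [← norm_iteratedFDeriv_fderiv, h1]
    refine ih (hκ.fderiv_right (m := ∞) (by simp)) (hs.fderiv ℝ) (fun z => ?_) x
    rw [norm_iteratedFDeriv_fderiv]
    exact hM z

/-- Interior estimates for the Helmholtz equation. -/
lemma exists_interior_estimate (k : ℝ) {ε : ℝ} (hε : 0 < ε) (n : ℕ) :
    ∃ M : ℝ, 0 ≤ M ∧ ∀ (f : E3 → ℝ) (x : E3), (∀ y ∈ ball x (3 * ε), ContDiffAt ℝ ∞ f y) →
      (∀ y ∈ ball x (3 * ε), helm k f y = 0) → IntegrableOn f (ball x (3 * ε)) →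
      ∀ j ≤ n, ‖iteratedFDeriv ℝ j f x‖ ≤ M * ∫ y in ball x (3 * ε), |f y| := by
  set κ : E3 → ℝ := fun z => reproK k ε (-z) with hκdef
  have hκ : ContDiff ℝ ∞ κ := (contDiff_reproK k hε).comp contDiff_neg
  have hκs : HasCompactSupport κ :=
    (hasCompactSupport_reproK k hε).comp_homeomorph (Homeomorph.neg E3)
  have hb : ∀ j, ∃ M, ∀ z, ‖iteratedFDeriv ℝ j κ z‖ ≤ M := fun j =>
    (hκs.iteratedFDeriv j).exists_bound_of_continuous
      (hκ.continuous_iteratedFDeriv (mod_cast le_top))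
  choose M hM using hb
  have hM0 : ∀ j, 0 ≤ M j := fun j => (norm_nonneg _).trans (hM j 0)
  refine ⟨∑ j ∈ Finset.range (n + 1), M j, Finset.sum_nonneg fun j _ => hM0 j, ?_⟩
  intro f x hf hfk hfi j hj
  obtain ⟨h, hh, hhs, hsub, heq, hle⟩ := exists_truncation (isCompact_closedBall x (2 * ε))
    isOpen_ball (closedBall_subset_ball (by linarith : 2 * ε < 3 * ε)) hf
  have hhi : Integrable h := hh.continuous.integrable_of_hasCompactSupport hhs
  have hfc : f =ᶠ[𝓝 x] conv h κ := by
    filter_upwards [ball_mem_nhds x hε] with z hz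
    have hz2 : z ∈ closedBall x (2 * ε) := by
      rw [mem_ball] at hz
      rw [mem_closedBall]
      linarith
    rw [← (heq z hz2).eq_of_nhds, eq_integral_reproK k hε hh hhs (x := z) (fun y hy => ?_)]
    · simp [conv, hκdef]
    · have hy2 : y ∈ closedBall x (2 * ε) := by
        rw [mem_ball] at hz hy
        rw [mem_closedBall]
        linarith [dist_triangle y z x]
      rw [helm_congr k (heq y hy2)]
      exact hfk y (closedBall_subset_ball (by linarith) hy2)
  have hint : ∫ y, |h y| ≤ ∫ y in ball x (3 * ε), |f y| := by
    rw [← setIntegral_eq_integral_of_forall_compl_eq_zero (s := ball x (3 * ε))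
      (fun y hy => by rw [image_eq_zero_of_notMem_tsupport (fun h => hy (hsub h)), abs_zero])]
    exact setIntegral_mono hhi.abs.integrableOn hfi.abs hle
  rw [(hfc.iteratedFDeriv ℝ j).eq_of_nhds]
  calc _ ≤ M j * ∫ y, |h y| := norm_iteratedFDeriv_conv_le hhi j hκ hκs (hM j) x
    _ ≤ (∑ j ∈ Finset.range (n + 1), M j) * ∫ y in ball x (3 * ε), |f y| := by
      refine mul_le_mul ?_ hint (integral_nonneg fun y => abs_nonneg _)
        (Finset.sum_nonneg fun j _ => hM0 j)
      exact Finset.single_le_sum (f := M) (fun j _ => hM0 j) (Finset.mem_range.2 (by omega))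

end InteriorEstimate

section Holomorphy

/-- Integrals of holomorphic kernels over a compact set are holomorphic in the parameter. -/
lemma differentiableOn_integral_kernel {L : Set E3} (hL : IsCompact L) {g : E3 → ℝ}
    (hg : IntegrableOn g L) {U : Set ℂ} (hU : IsOpen U) {κ : E3 → ℂ → ℂ}
    (hκ : ContinuousOn (Function.uncurry κ) (L ×ˢ U))
    (hκd : ∀ x ∈ L, DifferentiableOn ℂ (κ x) U) :
    DifferentiableOn ℂ (fun t => ∫ x in L, (g x : ℂ) * κ x t) U := by
  intro t₀ ht₀
  obtain ⟨ρ, hρ, hρU⟩ := Metric.isOpen_iff.1 hU t₀ ht₀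
  set r := ρ / 3 with hr
  have hr0 : 0 < r := by positivity
  have hsub : closedBall t₀ (2 * r) ⊆ U :=
    (closedBall_subset_ball (by rw [hr]; linarith)).trans hρU
  obtain ⟨M, hM⟩ := (hL.prod (isCompact_closedBall t₀ (2 * r))).exists_bound_of_continuousOn
    (hκ.mono (prod_mono_right hsub))
  have hLm := hL.measurableSet
  have hgm : AEStronglyMeasurable (fun x => (g x : ℂ)) (volume.restrict L) :=
    Complex.continuous_ofReal.comp_aestronglyMeasurable hg.aestronglyMeasurable
  have hκm : ∀ t ∈ U, AEStronglyMeasurable (fun x => κ x t) (volume.restrict L) := by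
    intro t ht
    refine ContinuousOn.aestronglyMeasurable ?_ hLm
    exact hκ.comp (f := fun x : E3 => (x, t)) (by fun_prop) fun x hx => ⟨hx, ht⟩
  have hderiv : ∀ x ∈ L, ∀ t ∈ U, HasDerivAt (κ x) (deriv (κ x) t) t := fun x hx t ht =>
    ((hκd x hx).differentiableAt (hU.mem_nhds ht)).hasDerivAt
  have hdm : AEStronglyMeasurable (fun x => deriv (κ x) t₀) (volume.restrict L) := by
    set s : ℕ → ℂ := fun n => t₀ + ((r * (1 / ((n : ℝ) + 1)) : ℝ) : ℂ) with hs
    have hs0 : Tendsto s atTop (𝓝 t₀) := by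
      have h1 : Tendsto (fun n : ℕ => r * (1 / ((n : ℝ) + 1))) atTop (𝓝 (r * 0)) :=
        tendsto_one_div_add_atTop_nhds_zero_nat.const_mul r
      have h2 := (Complex.continuous_ofReal.tendsto _).comp h1
      simpa [hs, Function.comp_def] using h2.const_add t₀
    have hs1 : Tendsto s atTop (𝓝[≠] t₀) := by
      refine tendsto_nhdsWithin_iff.2 ⟨hs0, Eventually.of_forall fun n => ?_⟩
      have : (r * (1 / ((n : ℝ) + 1)) : ℝ) ≠ 0 := by positivity
      simp only [hs, mem_compl_iff, mem_singleton_iff, add_eq_left]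
      exact_mod_cast this
    have hsU : ∀ᶠ n in atTop, s n ∈ U := hs0.eventually (hU.mem_nhds ht₀)
    obtain ⟨N, hN⟩ := eventually_atTop.1 hsU
    refine aestronglyMeasurable_of_tendsto_ae atTop
      (f := fun n x => slope (κ x) t₀ (s (n + N))) (fun n => ?_) ?_
    · exact AEStronglyMeasurable.const_smul
        ((hκm _ (hN (n + N) (by omega))).sub (hκm _ ht₀)) (s (n + N) - t₀)⁻¹
    · refine (ae_restrict_iff' hLm).2 (Eventually.of_forall fun x hx => ?_)
      exact ((hderiv x hx t₀ ht₀).tendsto_slope.comp hs1).comp (tendsto_add_atTop_nat N)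
  have key := hasDerivAt_integral_of_dominated_loc_of_deriv_le (𝕜 := ℂ) (μ := volume.restrict L)
    (F := fun t x => (g x : ℂ) * κ x t) (F' := fun t x => (g x : ℂ) * deriv (κ x) t)
    (bound := fun x => |g x| * (M / r)) (x₀ := t₀) (ball_mem_nhds t₀ hr0)
    ?_ ?_ (hgm.mul hdm) ?_ (hg.abs.mul_const _) ?_
  · exact key.2.differentiableAt.differentiableWithinAt
  · filter_upwards [hU.mem_nhds ht₀] with t ht using hgm.mul (hκm t ht)
  · refine (hg.abs.mul_const M).mono' (hgm.mul (hκm t₀ ht₀)) ?_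
    refine (ae_restrict_iff' hLm).2 (Eventually.of_forall fun x hx => ?_)
    rw [norm_mul, Complex.norm_real, Real.norm_eq_abs]
    exact mul_le_mul_of_nonneg_left (hM (x, t₀) ⟨hx, mem_closedBall_self (by positivity)⟩)
      (abs_nonneg _)
  · refine (ae_restrict_iff' hLm).2 (Eventually.of_forall fun x hx t ht => ?_)
    rw [norm_mul, Complex.norm_real, Real.norm_eq_abs]
    refine mul_le_mul_of_nonneg_left ?_ (abs_nonneg _)
    have hcb : closedBall t r ⊆ closedBall t₀ (2 * r) := by
      intro z hz
      rw [mem_closedBall] at hz ⊢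
      rw [mem_ball] at ht
      linarith [dist_triangle z t t₀]
    refine Complex.norm_deriv_le_of_forall_mem_sphere_norm_le hr0
      (((hκd x hx).mono (hcb.trans hsub)).diffContOnCl_ball subset_rfl) fun z hz => ?_
    exact hM (x, z) ⟨hx, hcb (sphere_subset_closedBall hz)⟩
  · refine (ae_restrict_iff' hLm).2 (Eventually.of_forall fun x hx t ht => ?_)
    refine (hderiv x hx t (hsub (?_ : t ∈ closedBall t₀ (2 * r)))).const_mul _
    exact ball_subset_closedBall (ball_subset_ball (by linarith) ht)

lemma differentiableAt_sqrt {z : ℂ} (hz : z ∈ Complex.slitPlane) :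
    DifferentiableAt ℂ Complex.sqrt z := by
  unfold Complex.sqrt
  exact differentiableAt_id.cpow (differentiableAt_const _) hz

lemma sqrt_ofReal {a : ℝ} (ha : 0 ≤ a) : Complex.sqrt (a : ℂ) = ((√a : ℝ) : ℂ) := by
  rw [Complex.sqrt_of_nonneg (by exact_mod_cast ha)]
  simp

lemma sqrt_re_pos {z : ℂ} (hz : z ∈ Complex.slitPlane) : 0 < (Complex.sqrt z).re := by
  have h := Complex.cpow_inv_two_re z
  rw [Complex.sqrt, h]
  refine Real.sqrt_pos.2 ?_
  have := Complex.mem_slitPlane_iff_not_le_zero.1 hz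
  have h1 := Complex.abs_re_le_norm z
  rcases Complex.mem_slitPlane_iff.1 hz with h2 | h2
  · have := norm_nonneg z; positivity
  · have h3 : |z.re| < ‖z‖ := Complex.abs_re_lt_norm.2 h2
    have := neg_abs_le z.re
    linarith

lemma mem_slitPlane_of_norm_sub_one_lt {z : ℂ} (h : ‖z - 1‖ < 1) : z ∈ Complex.slitPlane := by
  refine Complex.mem_slitPlane_iff.2 (Or.inl ?_)
  have := (Complex.abs_re_le_norm (z - 1)).trans_lt h
  rw [Complex.sub_re, Complex.one_re, abs_lt] at this
  linarith [this.1]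

end Holomorphy

section FarField

lemma eqOn_zero_of_tendsto {f : ℂ → ℂ} {r : ℝ} (hr : 0 < r)
    (hf : DifferentiableOn ℂ f (ball 0 r)) {s : ℕ → ℝ} (hs : Tendsto s atTop (𝓝 0))
    (hs0 : ∀ n, s n ≠ 0) (h : ∀ᶠ n in atTop, f (s n) = 0) : EqOn f 0 (ball 0 r) := by
  refine (hf.analyticOnNhd isOpen_ball).eqOn_zero_of_preconnected_of_frequently_eq_zero
    (convex_ball 0 r).isPreconnected (mem_ball_self hr) ?_
  have h1 : Tendsto (fun n => (s n : ℂ)) atTop (𝓝[≠] 0) := by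
    refine tendsto_nhdsWithin_iff.2 ⟨?_, Eventually.of_forall fun n => by simpa using hs0 n⟩
    simpa [Function.comp_def] using (Complex.continuous_ofReal.tendsto 0).comp hs
  exact h1.frequently h.frequently

lemma continuousOn_sqrt_comp {X : Type} [TopologicalSpace X] {q : X → ℂ} {S : Set X}
    (hq : ContinuousOn q S) (h : ∀ x ∈ S, q x ∈ Complex.slitPlane) :
    ContinuousOn (fun x => Complex.sqrt (q x)) S := fun x hx =>
  (differentiableAt_sqrt (h x hx)).continuousAt.comp_continuousWithinAt (hq x hx)

lemma differentiableOn_sqrt_comp {q : ℂ → ℂ} {S : Set ℂ}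
    (hq : DifferentiableOn ℂ q S) (h : ∀ x ∈ S, q x ∈ Complex.slitPlane) :
    DifferentiableOn ℂ (fun x => Complex.sqrt (q x)) S := fun x hx =>
  (differentiableAt_sqrt (h x hx)).comp_differentiableWithinAt x (hq x hx)

lemma sqrt_ne_zero {z : ℂ} (hz : z ∈ Complex.slitPlane) : Complex.sqrt z ≠ 0 := fun h => by
  simpa [h] using sqrt_re_pos hz

lemma sqrt_add_one_ne_zero {z : ℂ} (hz : z ∈ Complex.slitPlane) : Complex.sqrt z + 1 ≠ 0 :=
  fun h => by
    have h1 := sqrt_re_pos hz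
    have h2 := congrArg Complex.re h
    simp at h2
    linarith

/-- The singular radial solution of the Helmholtz equation. -/
def cosK (k : ℝ) (z : E3) : ℝ := Real.cos (k * ‖z‖) / ‖z‖

/-- The potential of a density on `L` with respect to the singular radial solution. -/
def potential (k : ℝ) (L : Set E3) (g : E3 → ℝ) (y : E3) : ℝ :=
  ∫ x in L, g x * cosK k (x - y)

/-- The rescaled squared distance from `x` to the point `s⁻¹ • e`. -/
def farSq (e x : E3) (s : ℂ) : ℂ := 1 - 2 * s * (⟪x, e⟫ : ℝ) + s ^ 2 * (‖x‖ ^ 2 : ℝ)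

/-- The phase shift of a spherical wave centred at `s⁻¹ • e`. -/
def farPhase (e x : E3) (s : ℂ) : ℂ :=
  (-2 * (⟪x, e⟫ : ℝ) + s * (‖x‖ ^ 2 : ℝ)) / (Complex.sqrt (farSq e x s) + 1)

lemma continuous_farSq (e : E3) : Continuous (Function.uncurry (farSq e)) := by
  unfold farSq Function.uncurry
  fun_prop

lemma differentiable_farSq (e x : E3) : Differentiable ℂ (farSq e x) := by
  unfold farSq
  fun_prop

lemma norm_farSq_sub_one_lt {e x : E3} (he : ‖e‖ = 1) {R : ℝ} (hR : 0 < R) (hx : ‖x‖ ≤ R)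
    {s : ℂ} (hs : s ∈ ball (0 : ℂ) (1 / (3 * R))) : ‖farSq e x s - 1‖ < 1 := by
  rw [mem_ball_zero_iff, lt_div_iff₀ (by positivity)] at hs
  have h1 : |⟪x, e⟫| ≤ R := (abs_real_inner_le_norm x e).trans (by rw [he, mul_one]; exact hx)
  have h2 : farSq e x s - 1 = -(2 * s * (⟪x, e⟫ : ℝ)) + s ^ 2 * (‖x‖ ^ 2 : ℝ) := by
    unfold farSq; ring
  have h3 : ‖farSq e x s - 1‖ ≤ 2 * ‖s‖ * |⟪x, e⟫| + ‖s‖ ^ 2 * ‖x‖ ^ 2 := by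
    rw [h2]
    refine (norm_add_le _ _).trans (le_of_eq ?_)
    simp
  have h4 : 2 * ‖s‖ * |⟪x, e⟫| ≤ 2 * ‖s‖ * R := by gcongr
  have h5 : ‖s‖ ^ 2 * ‖x‖ ^ 2 ≤ ‖s‖ ^ 2 * R ^ 2 := by gcongr
  have h6 : 0 ≤ ‖s‖ * R := by positivity
  nlinarith

lemma farSq_mem_slitPlane {e x : E3} (he : ‖e‖ = 1) {R : ℝ} (hR : 0 < R) (hx : ‖x‖ ≤ R)
    {s : ℂ} (hs : s ∈ ball (0 : ℂ) (1 / (3 * R))) : farSq e x s ∈ Complex.slitPlane :=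
  mem_slitPlane_of_norm_sub_one_lt (norm_farSq_sub_one_lt he hR hx hs)

lemma farSq_ofReal {e x : E3} (he : ‖e‖ = 1) {s : ℝ} (hs : 0 < s) :
    farSq e x s = (((s * ‖x - s⁻¹ • e‖) ^ 2 : ℝ) : ℂ) := by
  have h : (s * ‖x - s⁻¹ • e‖) ^ 2 = 1 - 2 * s * ⟪x, e⟫ + s ^ 2 * ‖x‖ ^ 2 := by
    rw [mul_pow, norm_sub_sq_real, norm_smul, inner_smul_right, he, norm_inv, Real.norm_eq_abs,
      abs_of_pos hs]
    field_simp
    ring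
  rw [h]
  unfold farSq
  push_cast
  rfl

lemma sqrt_farSq_ofReal {e x : E3} (he : ‖e‖ = 1) {s : ℝ} (hs : 0 < s) :
    Complex.sqrt (farSq e x s) = ((s * ‖x - s⁻¹ • e‖ : ℝ) : ℂ) := by
  rw [farSq_ofReal he hs, sqrt_ofReal (sq_nonneg _), Real.sqrt_sq (by positivity)]

lemma farPhase_ofReal {e x : E3} (he : ‖e‖ = 1) {s : ℝ} (hs : 0 < s) :
    farPhase e x s = ((‖x - s⁻¹ • e‖ - s⁻¹ : ℝ) : ℂ) := by
  have h1 : ((s * ‖x - s⁻¹ • e‖ + 1 : ℝ) : ℂ) ≠ 0 := by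
    have : s * ‖x - s⁻¹ • e‖ + 1 ≠ 0 := by positivity
    exact_mod_cast this
  have h2 : farSq e x s = _ := farSq_ofReal he hs
  have hsc : (s : ℂ) ≠ 0 := by exact_mod_cast hs.ne'
  unfold farPhase
  rw [sqrt_farSq_ofReal he hs]
  push_cast at h1 ⊢
  rw [div_eq_iff h1]
  unfold farSq at h2
  push_cast at h2
  generalize ‖x - s⁻¹ • e‖ = d at h2 ⊢
  field_simp
  linear_combination h2

lemma potential_eq_zero_of_large {k : ℝ} (hk : 0 < k) {L : Set E3} (hL : IsCompact L)
    {g : E3 → ℝ} (hg : IntegrableOn g L) {R : ℝ} (hR : 0 < R) (hLR : ∀ x ∈ L, ‖x‖ ≤ R)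
    (hG : ∀ y, ∫ x in L, g x * regK k (x - y) = 0) {y : E3} (hy : 3 * R < ‖y‖) :
    potential k L g y = 0 := by
  have hy0 : 0 < ‖y‖ := lt_trans (by positivity) hy
  set e := ‖y‖⁻¹ • y with hedef
  have he : ‖e‖ = 1 := by
    rw [hedef, norm_smul, norm_inv, norm_norm, inv_mul_cancel₀ hy0.ne']
  set r := 1 / (3 * R) with hrdef
  have hr : 0 < r := by positivity
  have hslit : ∀ x ∈ L, ∀ s ∈ ball (0 : ℂ) r, farSq e x s ∈ Complex.slitPlane :=
    fun x hx s hs => farSq_mem_slitPlane he hR (hLR x hx) hs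
  have hsqc : ContinuousOn (fun z : E3 × ℂ => Complex.sqrt (farSq e z.1 z.2)) (L ×ˢ ball 0 r) :=
    continuousOn_sqrt_comp (continuous_farSq e).continuousOn fun z hz => hslit _ hz.1 _ hz.2
  have hphc : ContinuousOn (fun z : E3 × ℂ => farPhase e z.1 z.2) (L ×ˢ ball 0 r) := by
    unfold farPhase
    refine ContinuousOn.div (by fun_prop) (hsqc.add continuousOn_const) fun z hz => ?_
    exact sqrt_add_one_ne_zero (hslit _ hz.1 _ hz.2)
  have hsqd : ∀ x ∈ L, DifferentiableOn ℂ (fun s => Complex.sqrt (farSq e x s)) (ball 0 r) :=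
    fun x hx => differentiableOn_sqrt_comp (differentiable_farSq e x).differentiableOn (hslit x hx)
  have hphd : ∀ x ∈ L, DifferentiableOn ℂ (farPhase e x) (ball 0 r) := by
    intro x hx
    unfold farPhase
    refine DifferentiableOn.div (by fun_prop) ((hsqd x hx).add_const _) fun s hs => ?_
    exact sqrt_add_one_ne_zero (hslit _ hx _ hs)
  set P : ℂ → ℂ := fun s => ∫ x in L,
    (g x : ℂ) * (Complex.cos (k * farPhase e x s) / Complex.sqrt (farSq e x s)) with hP
  set Q : ℂ → ℂ := fun s => ∫ x in L,
    (g x : ℂ) * (Complex.sin (k * farPhase e x s) / Complex.sqrt (farSq e x s)) with hQ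
  have hPd : DifferentiableOn ℂ P (ball 0 r) := by
    refine differentiableOn_integral_kernel hL hg isOpen_ball
      (κ := fun x s => Complex.cos (k * farPhase e x s) / Complex.sqrt (farSq e x s)) ?_ ?_
    · exact ContinuousOn.div
        (Complex.continuous_cos.comp_continuousOn (continuousOn_const.mul hphc))
        hsqc fun z hz => sqrt_ne_zero (hslit _ hz.1 _ hz.2)
    · exact fun x hx => DifferentiableOn.div ((hphd x hx).const_mul _).ccos (hsqd x hx)
        fun s hs => sqrt_ne_zero (hslit _ hx _ hs)
  have hQd : DifferentiableOn ℂ Q (ball 0 r) := by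
    refine differentiableOn_integral_kernel hL hg isOpen_ball
      (κ := fun x s => Complex.sin (k * farPhase e x s) / Complex.sqrt (farSq e x s)) ?_ ?_
    · exact ContinuousOn.div
        (Complex.continuous_sin.comp_continuousOn (continuousOn_const.mul hphc))
        hsqc fun z hz => sqrt_ne_zero (hslit _ hz.1 _ hz.2)
    · exact fun x hx => DifferentiableOn.div ((hphd x hx).const_mul _).csin (hsqd x hx)
        fun s hs => sqrt_ne_zero (hslit _ hx _ hs)
  set Pr : ℝ → ℝ := fun s => ∫ x in L,
    g x * (Real.cos (k * (‖x - s⁻¹ • e‖ - s⁻¹)) / (s * ‖x - s⁻¹ • e‖)) with hPr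
  set Qr : ℝ → ℝ := fun s => ∫ x in L,
    g x * (Real.sin (k * (‖x - s⁻¹ • e‖ - s⁻¹)) / (s * ‖x - s⁻¹ • e‖)) with hQr
  have hPc : ∀ s : ℝ, 0 < s → P s = (Pr s : ℂ) := by
    intro s hs
    simp only [hP, hPr, sqrt_farSq_ofReal he hs, farPhase_ofReal he hs]
    rw [← integral_complex_ofReal]
    simp
  have hQc : ∀ s : ℝ, 0 < s → Q s = (Qr s : ℂ) := by
    intro s hs
    simp only [hQ, hQr, sqrt_farSq_ofReal he hs, farPhase_ofReal he hs]
    rw [← integral_complex_ofReal]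
    simp
  have hdist : ∀ s : ℝ, 0 < s → s < r → ∀ x ∈ L, 0 < ‖x - s⁻¹ • e‖ := by
    intro s hs hsr x hx
    have h1 : 3 * R < s⁻¹ := by
      rw [hrdef, lt_div_iff₀ (by positivity)] at hsr
      rw [lt_inv_comm₀ (by positivity) hs, ← one_div, lt_div_iff₀ (by positivity)]
      exact hsr
    have h2 : ‖s⁻¹ • e‖ = s⁻¹ := by rw [norm_smul, he, norm_inv, Real.norm_of_nonneg hs.le, mul_one]
    have h3 := norm_sub_norm_le (s⁻¹ • e) x
    rw [norm_sub_rev, h2] at h3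
    linarith [hLR x hx]
  have hcos : ∀ s : ℝ, 0 < s → s < r → IntegrableOn (fun x =>
      g x * (Real.cos (k * (‖x - s⁻¹ • e‖ - s⁻¹)) / (s * ‖x - s⁻¹ • e‖))) L := by
    intro s hs hsr
    refine hg.mul_continuousOn ?_ hL
    refine ContinuousOn.div (by fun_prop) (by fun_prop) fun x hx => ?_
    have := hdist s hs hsr x hx
    positivity
  have hsin : ∀ s : ℝ, 0 < s → s < r → IntegrableOn (fun x =>
      g x * (Real.sin (k * (‖x - s⁻¹ • e‖ - s⁻¹)) / (s * ‖x - s⁻¹ • e‖))) L := by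
    intro s hs hsr
    refine hg.mul_continuousOn ?_ hL
    refine ContinuousOn.div (by fun_prop) (by fun_prop) fun x hx => ?_
    have := hdist s hs hsr x hx
    positivity
  have hreg : ∀ s : ℝ, 0 < s → s < r →
      Real.sin (k / s) * Pr s + Real.cos (k / s) * Qr s = 0 := by
    intro s hs hsr
    rw [← mul_zero (k / s), ← hG (s⁻¹ • e), hPr, hQr, ← integral_const_mul, ← integral_const_mul,
      ← integral_const_mul, ← integral_add ((hcos s hs hsr).const_mul _)
      ((hsin s hs hsr).const_mul _)]
    refine setIntegral_congr_fun hL.measurableSet fun x hx => ?_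
    have hd := hdist s hs hsr x hx
    have h1 : k * ‖x - s⁻¹ • e‖ = k / s + k * (‖x - s⁻¹ • e‖ - s⁻¹) := by field_simp; ring
    rw [regK_eq_sinc, Real.sinc_of_ne_zero (by positivity), h1, Real.sin_add, ← h1]
    field_simp
  have hpot : ∀ s : ℝ, 0 < s → s < r → potential k L g (s⁻¹ • e) =
      s * (Real.cos (k / s) * Pr s - Real.sin (k / s) * Qr s) := by
    intro s hs hsr
    rw [potential, hPr, hQr, ← integral_const_mul, ← integral_const_mul,
      ← integral_sub ((hcos s hs hsr).const_mul _) ((hsin s hs hsr).const_mul _),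
      ← integral_const_mul]
    refine setIntegral_congr_fun hL.measurableSet fun x hx => ?_
    have hd := hdist s hs hsr x hx
    have h1 : k * ‖x - s⁻¹ • e‖ = k / s + k * (‖x - s⁻¹ • e‖ - s⁻¹) := by field_simp; ring
    simp only [cosK]
    rw [h1, Real.cos_add]
    field_simp
  have hn : Tendsto (fun n : ℕ => (n : ℝ) * Real.pi) atTop atTop :=
    tendsto_natCast_atTop_atTop.atTop_mul_const Real.pi_pos
  have hseq : ∀ c : ℝ, Tendsto (fun n : ℕ => k / ((n : ℝ) * Real.pi + c)) atTop (𝓝 0) := fun c =>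
    (tendsto_atTop_add_const_right _ c hn).const_div_atTop k
  have hQ0 : EqOn Q 0 (ball 0 r) := by
    refine eqOn_zero_of_tendsto hr hQd (hseq Real.pi) (fun n => by positivity) ?_
    filter_upwards [(hseq Real.pi).eventually_lt_const hr] with n hnr
    have hp : 0 < k / ((n : ℝ) * Real.pi + Real.pi) := by positivity
    have h1 := hreg _ hp hnr
    rw [div_div_cancel₀ hk.ne', Real.sin_add_pi, Real.sin_nat_mul_pi, Real.cos_add_pi] at h1
    rw [hQc _ hp]
    have h2 := Real.sin_sq_add_cos_sq (n * Real.pi)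
    rw [Real.sin_nat_mul_pi] at h2
    have h3 : Real.cos (n * Real.pi) ≠ 0 := fun h => by rw [h] at h2; norm_num at h2
    have h4 : Qr (k / ((n : ℝ) * Real.pi + Real.pi)) = 0 := by
      simpa [h3] using h1
    rw [h4, Complex.ofReal_zero]
  have hP0 : EqOn P 0 (ball 0 r) := by
    refine eqOn_zero_of_tendsto hr hPd (hseq (Real.pi / 2)) (fun n => by positivity) ?_
    filter_upwards [(hseq (Real.pi / 2)).eventually_lt_const hr] with n hnr
    have hp : 0 < k / ((n : ℝ) * Real.pi + Real.pi / 2) := by positivity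
    have h1 := hreg _ hp hnr
    rw [div_div_cancel₀ hk.ne', Real.sin_add_pi_div_two, Real.cos_add_pi_div_two,
      Real.sin_nat_mul_pi] at h1
    rw [hPc _ hp]
    have h2 := Real.sin_sq_add_cos_sq (n * Real.pi)
    rw [Real.sin_nat_mul_pi] at h2
    have h3 : Real.cos (n * Real.pi) ≠ 0 := fun h => by rw [h] at h2; norm_num at h2
    have h4 : Pr (k / ((n : ℝ) * Real.pi + Real.pi / 2)) = 0 := by
      simpa [h3] using h1
    rw [h4, Complex.ofReal_zero]
  have hs : 0 < ‖y‖⁻¹ := by positivity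
  have hsr : ‖y‖⁻¹ < r := by
    rw [hrdef, one_div]
    exact inv_strictAnti₀ (by positivity) hy
  have hmem : ((‖y‖⁻¹ : ℝ) : ℂ) ∈ ball (0 : ℂ) r := by
    rw [mem_ball_zero_iff, Complex.norm_real, Real.norm_of_nonneg hs.le]
    exact hsr
  have e1 : Pr ‖y‖⁻¹ = 0 := by
    have := hP0 hmem
    rw [hPc _ hs, Pi.zero_apply] at this
    exact_mod_cast this
  have e2 : Qr ‖y‖⁻¹ = 0 := by
    have := hQ0 hmem
    rw [hQc _ hs, Pi.zero_apply] at this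
    exact_mod_cast this
  have hfin := hpot _ hs hsr
  rw [e1, e2, hedef, smul_smul, inv_inv, mul_inv_cancel₀ hy0.ne', one_smul] at hfin
  rw [hfin]
  ring

end FarField

section UniqueContinuation

/-- The complexified squared length of `a - t • d`. -/
def segSq (a d : E3) (t : ℂ) : ℂ := (‖a‖ ^ 2 : ℝ) - 2 * t * (⟪a, d⟫ : ℝ) + t ^ 2 * (‖d‖ ^ 2 : ℝ)

lemma segSq_ofReal (a d : E3) (t : ℝ) : segSq a d t = ((‖a - t • d‖ ^ 2 : ℝ) : ℂ) := by
  have h : ‖a - t • d‖ ^ 2 = ‖a‖ ^ 2 - 2 * t * ⟪a, d⟫ + t ^ 2 * ‖d‖ ^ 2 := by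
    rw [norm_sub_sq_real, norm_smul, inner_smul_right, mul_pow, Real.norm_eq_abs, sq_abs]
    ring
  rw [h]
  unfold segSq
  push_cast
  rfl

lemma segSq_mem_slitPlane {a d : E3} (had : 7 * ‖d‖ < ‖a‖) {t : ℂ} (ht : t ∈ ball (0 : ℂ) 2) :
    segSq a d t ∈ Complex.slitPlane := by
  rw [mem_ball_zero_iff] at ht
  refine Complex.mem_slitPlane_iff.2 (Or.inl ?_)
  have h0 := norm_nonneg d
  have h1 : |⟪a, d⟫| ≤ ‖a‖ * ‖d‖ := abs_real_inner_le_norm a d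
  set w : ℂ := 2 * t * (⟪a, d⟫ : ℝ) - t ^ 2 * (‖d‖ ^ 2 : ℝ) with hw
  have h2 : segSq a d t = (‖a‖ ^ 2 : ℝ) - w := by unfold segSq; rw [hw]; ring
  have h3 : ‖w‖ ≤ 2 * ‖t‖ * |⟪a, d⟫| + ‖t‖ ^ 2 * ‖d‖ ^ 2 := by
    refine (norm_sub_le _ _).trans (le_of_eq ?_)
    simp
  have h4 : 2 * ‖t‖ * |⟪a, d⟫| ≤ 2 * 2 * (‖a‖ * ‖d‖) := by gcongr
  have h5 : ‖t‖ ^ 2 * ‖d‖ ^ 2 ≤ 2 ^ 2 * ‖d‖ ^ 2 := by gcongr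
  rw [h2, Complex.sub_re, Complex.ofReal_re]
  have h6 := Complex.re_le_norm w
  nlinarith

lemma potential_eq_zero_of_near {k : ℝ} {L : Set E3} (hL : IsCompact L) {g : E3 → ℝ}
    (hg : IntegrableOn g L) {z y : E3} (hzy : ∀ x ∈ L, 7 * ‖y - z‖ < ‖x - z‖)
    (hz : ∀ᶠ w in 𝓝 z, potential k L g w = 0) : potential k L g y = 0 := by
  set d := y - z with hd
  set κ : E3 → ℂ → ℂ := fun x t =>
    Complex.cos (k * Complex.sqrt (segSq (x - z) d t)) / Complex.sqrt (segSq (x - z) d t) with hκ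
  have hslit : ∀ x ∈ L, ∀ t ∈ ball (0 : ℂ) 2, segSq (x - z) d t ∈ Complex.slitPlane :=
    fun x hx t ht => segSq_mem_slitPlane (hzy x hx) ht
  have hsqc : ContinuousOn (fun p : E3 × ℂ => Complex.sqrt (segSq (p.1 - z) d p.2))
      (L ×ˢ ball 0 2) := by
    refine continuousOn_sqrt_comp ?_ fun p hp => hslit _ hp.1 _ hp.2
    unfold segSq
    fun_prop
  have hsqd : ∀ x ∈ L, DifferentiableOn ℂ (fun t => Complex.sqrt (segSq (x - z) d t))
      (ball 0 2) := by
    intro x hx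
    refine differentiableOn_sqrt_comp ?_ (hslit x hx)
    unfold segSq
    fun_prop
  have hhol := differentiableOn_integral_kernel hL hg (isOpen_ball (x := (0 : ℂ)) (ε := 2))
    (κ := κ) (ContinuousOn.div (Complex.continuous_cos.comp_continuousOn
      (continuousOn_const.mul hsqc)) hsqc fun p hp => sqrt_ne_zero (hslit _ hp.1 _ hp.2))
    (fun x hx => DifferentiableOn.div ((hsqd x hx).const_mul _).ccos (hsqd x hx)
        fun t ht => sqrt_ne_zero (hslit _ hx _ ht))
  have hreal : ∀ t : ℝ, ∫ x in L, (g x : ℂ) * κ x t = (potential k L g (z + t • d) : ℂ) := by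
    intro t
    rw [potential, ← integral_complex_ofReal]
    refine setIntegral_congr_fun hL.measurableSet fun x _ => ?_
    simp only [hκ, cosK]
    rw [segSq_ofReal, sqrt_ofReal (sq_nonneg _), Real.sqrt_sq (norm_nonneg _), sub_sub]
    push_cast
    rfl
  have hzero := eqOn_zero_of_tendsto two_pos hhol (s := fun n : ℕ => 1 / ((n : ℝ) + 1))
    tendsto_one_div_add_atTop_nhds_zero_nat (fun n => by positivity) (by
      have h1 : Tendsto (fun n : ℕ => z + (1 / ((n : ℝ) + 1)) • d) atTop (𝓝 z) := by
        simpa using ((tendsto_one_div_add_atTop_nhds_zero_nat (𝕜 := ℝ)).smul_const d).const_add z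
      filter_upwards [h1.eventually hz] with n hn
      rw [hreal, hn, Complex.ofReal_zero])
  have h1 := hzero (show ((1 : ℝ) : ℂ) ∈ ball (0 : ℂ) 2 by simp)
  simp only [Pi.zero_apply] at h1
  rw [hreal, one_smul, hd, add_sub_cancel] at h1
  exact_mod_cast h1

lemma potential_eq_zero {k : ℝ} (hk : 0 < k) {L : Set E3} (hL : IsCompact L)
    (hLc : IsPreconnected Lᶜ) {g : E3 → ℝ} (hg : IntegrableOn g L)
    (hG : ∀ y, ∫ x in L, g x * regK k (x - y) = 0) {y : E3} (hy : y ∉ L) :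
    potential k L g y = 0 := by
  obtain ⟨R, hR, hLR⟩ := hL.isBounded.exists_pos_norm_le
  have hfar : ∀ y, 3 * R < ‖y‖ → potential k L g y = 0 := fun y hy =>
    potential_eq_zero_of_large hk hL hg hR hLR hG hy
  have hn : ‖(EuclideanSpace.single 0 (4 * R) : E3)‖ = 4 * R := by
    simp [abs_of_pos hR]
  have key : Lᶜ ⊆ interior {y | potential k L g y = 0} := by
    refine hLc.subset_of_closure_inter_subset isOpen_interior ?_ ?_
    · refine ⟨EuclideanSpace.single 0 (4 * R), fun h => ?_, ?_⟩
      · have := hLR _ h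
        rw [hn] at this
        linarith
      · refine mem_interior_iff_mem_nhds.2 ?_
        have : ∀ᶠ y in 𝓝 (EuclideanSpace.single 0 (4 * R) : E3), 3 * R < ‖y‖ := by
          refine continuous_norm.continuousAt.eventually_const_lt ?_
          exact (show 3 * R < 4 * R by linarith).trans_eq hn.symm
        exact this.mono hfar
    · rintro y₀ ⟨hcl, hy₀⟩
      obtain ⟨ρ, hρ, hρL⟩ := Metric.isOpen_iff.1 hL.isClosed.isOpen_compl y₀ hy₀
      obtain ⟨z, hz, hyz⟩ := Metric.mem_closure_iff.1 hcl (ρ / 16) (by positivity)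
      refine mem_interior_iff_mem_nhds.2 ?_
      filter_upwards [ball_mem_nhds y₀ (show 0 < ρ / 16 by positivity)] with y hy
      refine potential_eq_zero_of_near hL hg (z := z) (fun x hx => ?_)
        (mem_interior_iff_mem_nhds.1 hz)
      have h1 : ρ ≤ dist x y₀ := by
        by_contra! h
        exact hρL h hx
      rw [mem_ball] at hy
      rw [← dist_eq_norm, ← dist_eq_norm]
      have h2 := dist_triangle y y₀ z
      have h3 := dist_triangle x z y₀
      rw [dist_comm z y₀] at h3
      linarith
  have hmem : y ∈ {y | potential k L g y = 0} := interior_subset (key hy)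
  exact hmem

end UniqueContinuation

section Density

lemma exists_bound_cutK (k : ℝ) {ρ : ℝ} (hρ : 0 < ρ) : ∃ M, ∀ z, |cutK k (ρ ^ 2) z| ≤ M := by
  obtain ⟨M, hM⟩ := (isCompact_closedBall (0 : E3) ρ).exists_bound_of_continuousOn
    (contDiff_cutK k (show 0 < ρ ^ 2 by positivity)).continuous.continuousOn
  refine ⟨max M ρ⁻¹, fun z => ?_⟩
  by_cases hz : ‖z‖ ≤ ρ
  · exact le_max_of_le_left (hM z (by simpa using hz))
  · push Not at hz
    refine le_max_of_le_right ?_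
    rw [cutK_eq k (by positivity) (by gcongr), abs_div, abs_of_pos (hρ.trans hz), ← one_div]
    exact div_le_div₀ zero_le_one (Real.abs_cos_le_one _) hρ hz.le

lemma integral_mul_eq_zero {k : ℝ} (hk : 0 < k) {L : Set E3} (hL : IsCompact L)
    (hLc : IsPreconnected Lᶜ) {g : E3 → ℝ} (hg : IntegrableOn g L)
    (hG : ∀ y, ∫ x in L, g x * regK k (x - y) = 0) {K : Set E3} (hK : IsOpen K) (hLK : L ⊆ K)
    {f : E3 → ℝ} (hf : ∀ x ∈ K, ContDiffAt ℝ ∞ f x) (hfk : ∀ x ∈ K, helm k f x = 0) :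
    ∫ x in L, g x * f x = 0 := by
  obtain ⟨ρ, hρ, hρK⟩ := hL.exists_cthickening_subset_open hK hLK
  obtain ⟨h, hh, hhs, -, heq, -⟩ := exists_truncation hL.cthickening hK hρK hf
  have hnear : ∀ x ∈ L, ∀ y, dist y x < ρ → helm k h y = 0 := by
    intro x hx y hy
    have hy2 : y ∈ cthickening ρ L := mem_cthickening_of_dist_le y x ρ L hx hy.le
    rw [helm_congr k (heq y hy2)]
    exact hfk y (hρK hy2)
  have hrep : ∀ x ∈ L, f x = -fundConst⁻¹ * ∫ y, cutK k (ρ ^ 2) (y - x) * helm k h y := by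
    intro x hx
    rw [integral_cutK_mul_helm k hρ hh hhs (fun y hy => hnear x hx y hy),
      ← (heq x (self_subset_cthickening L hx)).eq_of_nhds]
    have := fundConst_pos.ne'
    field_simp
  obtain ⟨M, hM⟩ := exists_bound_cutK k hρ
  have hHi : Integrable (helm k h) :=
    (contDiff_helm k hh).continuous.integrable_of_hasCompactSupport (hasCompactSupport_helm k hhs)
  have hcut : Continuous (cutK k (ρ ^ 2)) := (contDiff_cutK k (by positivity)).continuous
  have hint : Integrable (Function.uncurry fun x y =>
      cutK k (ρ ^ 2) (y - x) * (g x * helm k h y)) ((volume.restrict L).prod volume) := by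
    refine (Integrable.mul_prod hg hHi).bdd_mul (c := M) ?_ (Eventually.of_forall fun p => hM _)
    exact Continuous.aestronglyMeasurable (by fun_prop)
  calc ∫ x in L, g x * f x
      = -fundConst⁻¹ * ∫ x in L, ∫ y, cutK k (ρ ^ 2) (y - x) * (g x * helm k h y) := by
        rw [← integral_const_mul]
        refine setIntegral_congr_fun hL.measurableSet fun x hx => ?_
        rw [hrep x hx, mul_left_comm, ← integral_const_mul]
        congr 2
        ext y
        ring
    _ = -fundConst⁻¹ * ∫ y, ∫ x in L, cutK k (ρ ^ 2) (y - x) * (g x * helm k h y) := by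
        rw [integral_integral_swap hint]
    _ = -fundConst⁻¹ * ∫ _ : E3, (0 : ℝ) := by
        congr 2
        ext y
        by_cases hy : ∃ x ∈ L, dist y x < ρ
        · obtain ⟨x, hx, hxy⟩ := hy
          simp [hnear x hx y hxy]
        · push Not at hy
          have hyL : y ∉ L := fun h => by
            have := hy y h
            rw [dist_self] at this
            linarith
          have hpot := potential_eq_zero hk hL hLc hg hG hyL
          rw [potential] at hpot
          rw [← mul_zero (helm k h y), ← hpot, ← integral_const_mul]
          refine setIntegral_congr_fun hL.measurableSet fun x hx => ?_
          have hd := hy x hx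
          rw [dist_eq_norm] at hd
          rw [cutK_eq k (by positivity) (by gcongr), cosK, norm_sub_rev]
          ring
    _ = 0 := by simp

/-- Entire solutions of the Helmholtz equation with sharp decay at infinity. -/
def decaying (k : ℝ) : Submodule ℝ (E3 → ℝ) where
  carrier := {w | ContDiff ℝ ∞ w ∧ (∀ x, helm k w x = 0) ∧ ∃ C, ∀ x, |w x| ≤ C / (1 + ‖x‖)}
  add_mem' := by
    rintro a b ⟨ha, ha0, A, hA⟩ ⟨hb, hb0, B, hB⟩
    refine ⟨ha.add hb, fun x => ?_, A + B, fun x => ?_⟩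
    · have := helm_add k ha.contDiffAt (hb.contDiffAt (x := x))
      rw [ha0, hb0, add_zero] at this
      exact this
    · rw [add_div]
      exact (abs_add_le _ _).trans (add_le_add (hA x) (hB x))
  zero_mem' := by
    refine ⟨contDiff_const, fun x => ?_, 0, fun x => by simp⟩
    exact helm_eq_zero_of_notMem_tsupport k (by simp)
  smul_mem' := by
    rintro c a ⟨ha, ha0, A, hA⟩
    refine ⟨contDiff_const.smul ha, fun x => ?_, |c| * A, fun x => ?_⟩
    · have := helm_const_mul k c (ha.contDiffAt (x := x))
      rw [ha0, mul_zero] at this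
      exact this
    · rw [Pi.smul_apply, smul_eq_mul, abs_mul, mul_div_assoc]
      exact mul_le_mul_of_nonneg_left (hA x) (abs_nonneg c)

lemma regK_sub_mem_decaying {k : ℝ} (hk : 0 < k) (y : E3) :
    (fun x => regK k (x - y)) ∈ decaying k := by
  refine ⟨(contDiff_regK k).comp (contDiff_id.sub contDiff_const), fun x => ?_,
    (1 + k⁻¹) * (1 + ‖y‖), fun x => ?_⟩
  · rw [helm_comp_sub_const, helm_regK hk]
  · refine (abs_regK_le hk _).trans ?_
    rw [div_le_div_iff₀ (by positivity) (by positivity), mul_assoc]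
    refine mul_le_mul_of_nonneg_left ?_ (by positivity)
    have := norm_sub_norm_le x y
    have := norm_nonneg (x - y)
    have := norm_nonneg y
    nlinarith

/-- The traces on `L`, in `L²`, of decaying entire solutions. -/
def decayingLp (k : ℝ) (L : Set E3) : Submodule ℝ (Lp ℝ 2 (volume.restrict L)) where
  carrier := {φ | ∃ w ∈ decaying k, φ =ᵐ[volume.restrict L] w}
  add_mem' := by
    rintro a b ⟨v, hv, hav⟩ ⟨w, hw, hbw⟩
    exact ⟨v + w, add_mem hv hw, (Lp.coeFn_add a b).trans (hav.add hbw)⟩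
  zero_mem' := ⟨0, zero_mem _, Lp.coeFn_zero _ _ _⟩
  smul_mem' := by
    rintro c a ⟨v, hv, hav⟩
    exact ⟨c • v, Submodule.smul_mem _ c hv, (Lp.coeFn_smul c a).trans (hav.const_smul c)⟩

lemma memLp_of_continuousOn {L : Set E3} (hL : IsCompact L) {f : E3 → ℝ} (hf : ContinuousOn f L) :
    MemLp f 2 (volume.restrict L) := by
  have : IsFiniteMeasure (volume.restrict L) := ⟨by simpa using hL.measure_lt_top⟩
  obtain ⟨M, hM⟩ := hL.exists_bound_of_continuousOn hf
  exact MemLp.of_bound (hf.aestronglyMeasurable hL.measurableSet) M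
    ((ae_restrict_iff' hL.measurableSet).2 (Eventually.of_forall hM))

/-- Runge approximation in `L¹` for the Helmholtz equation by decaying entire solutions. -/
lemma exists_decaying_approx {k : ℝ} (hk : 0 < k) {L : Set E3} (hL : IsCompact L)
    (hLc : IsPreconnected Lᶜ) {K : Set E3} (hK : IsOpen K) (hLK : L ⊆ K)
    {f : E3 → ℝ} (hf : ∀ x ∈ K, ContDiffAt ℝ ∞ f x) (hfk : ∀ x ∈ K, helm k f x = 0)
    {δ : ℝ} (hδ : 0 < δ) : ∃ w ∈ decaying k, ∫ x in L, |w x - f x| ≤ δ := by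
  have hfin : IsFiniteMeasure (volume.restrict L) := ⟨by simpa using hL.measure_lt_top⟩
  have hfL : MemLp f 2 (volume.restrict L) :=
    memLp_of_continuousOn hL fun x hx => (hf x (hLK hx)).continuousAt.continuousWithinAt
  have hmem : hfL.toLp f ∈ (decayingLp k L).topologicalClosure := by
    rw [← Submodule.orthogonal_orthogonal_eq_closure, Submodule.mem_orthogonal]
    intro g hg
    rw [Submodule.mem_orthogonal] at hg
    have hgi : IntegrableOn g L := (Lp.memLp g).integrable (by norm_num)
    have h0 := integral_mul_eq_zero hk hL hLc hgi (fun y => ?_) hK hLK hf hfk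
    · rw [L2.inner_def, ← h0]
      refine integral_congr_ae ?_
      filter_upwards [hfL.coeFn_toLp] with x hx
      rw [hx]
      simp [mul_comm]
    · have hm : MemLp (fun x => regK k (x - y)) 2 (volume.restrict L) :=
        memLp_of_continuousOn hL
          ((contDiff_regK k).continuous.comp (continuous_id.sub continuous_const)).continuousOn
      have h1 := hg (hm.toLp _) ⟨_, regK_sub_mem_decaying hk y, hm.coeFn_toLp⟩
      rw [L2.inner_def] at h1
      rw [← h1]
      refine integral_congr_ae ?_
      filter_upwards [hm.coeFn_toLp] with x hx
      rw [hx]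
      simp [mul_comm]
  set V := (volume.restrict L).real univ with hV
  have hV0 : 0 ≤ V := measureReal_nonneg
  obtain ⟨φ, ⟨w, hw, hφw⟩, hdist⟩ := Metric.mem_closure_iff.1 hmem (δ / (V + 1)) (by positivity)
  set η := δ / (V + 1) with hη
  have hη0 : 0 < η := by positivity
  set ψ := hfL.toLp f - φ with hψ
  rw [dist_eq_norm] at hdist
  have hψi : Integrable (fun x => ψ x ^ 2) (volume.restrict L) := by
    simpa using L2.integrable_inner (𝕜 := ℝ) ψ ψ
  have hsq : ∫ x in L, ψ x ^ 2 = ‖ψ‖ ^ 2 := by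
    rw [← real_inner_self_eq_norm_sq, L2.inner_def]
    simp
  refine ⟨w, hw, ?_⟩
  calc ∫ x in L, |w x - f x| = ∫ x in L, |ψ x| := by
        refine integral_congr_ae ?_
        filter_upwards [hφw, hfL.coeFn_toLp, Lp.coeFn_sub (hfL.toLp f) φ] with x h1 h2 h3
        rw [h3, Pi.sub_apply, h1, h2, abs_sub_comm]
    _ ≤ ∫ x in L, (η + η⁻¹ * (ψ x ^ 2)) := by
        refine integral_mono ((Lp.memLp ψ).integrable (by norm_num)).abs
          ((integrable_const η).add (hψi.const_mul _)) fun x => ?_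
        have h1 : 0 ≤ η⁻¹ * (|ψ x| - η) ^ 2 := by positivity
        have h2 : η⁻¹ * (|ψ x| - η) ^ 2 = η⁻¹ * (ψ x ^ 2) - 2 * |ψ x| + η := by
          rw [sub_sq, sq_abs]
          field_simp
        have h3 := abs_nonneg (ψ x)
        simp only
        linarith
    _ = η * V + η⁻¹ * ‖ψ‖ ^ 2 := by
        rw [integral_add (integrable_const η) (hψi.const_mul _), integral_const_mul, hsq,
          integral_const, smul_eq_mul, mul_comm η]
    _ ≤ η * V + η⁻¹ * η ^ 2 := by gcongr
    _ = δ := by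
        rw [hη]
        field_simp

end Density

section VectorFields

variable {w v : Fin 3 → E3 → ℝ} {x : E3}

/-- The curl of a triple of scalar components. -/
def curlc (w : Fin 3 → E3 → ℝ) (i : Fin 3) (x : E3) : ℝ :=
  pd3 (i + 1) (w (i + 2)) x - pd3 (i + 2) (w (i + 1)) x

/-- The divergence of a triple of scalar components. -/
def divc (w : Fin 3 → E3 → ℝ) (x : E3) : ℝ := ∑ i, pd3 i (w i) x

lemma curl3_apply (u : E3 → E3) (x : E3) (i : Fin 3) :
    curl3 u x i = curlc (fun j y => u y j) i x := by
  fin_cases i <;> simp [curl3, curlc, toE3]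

lemma contDiffAt_curlc (hw : ∀ j, ContDiffAt ℝ ∞ (w j) x) (i : Fin 3) :
    ContDiffAt ℝ ∞ (curlc w i) x :=
  (contDiffAt_pd3 _ (hw _)).sub (contDiffAt_pd3 _ (hw _))

lemma curlc_congr (h : ∀ j, w j =ᶠ[𝓝 x] v j) (i : Fin 3) : curlc w i =ᶠ[𝓝 x] curlc v i :=
  (pd3_congr _ (h _)).sub (pd3_congr _ (h _))

lemma curlc_add (hw : ∀ j, ContDiffAt ℝ ∞ (w j) x) (hv : ∀ j, ContDiffAt ℝ ∞ (v j) x)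
    (i : Fin 3) : curlc (fun j y => w j y + v j y) i x = curlc w i x + curlc v i x := by
  have hw' := fun j => (hw j).differentiableAt (by simp)
  have hv' := fun j => (hv j).differentiableAt (by simp)
  simp only [curlc]
  rw [pd3_add _ (hw' _) (hv' _), pd3_add _ (hw' _) (hv' _)]
  ring

lemma curlc_const_mul (c : ℝ) (hw : ∀ j, ContDiffAt ℝ ∞ (w j) x) (i : Fin 3) :
    curlc (fun j y => c * w j y) i x = c * curlc w i x := by
  have hw' := fun j => (hw j).differentiableAt (by simp)
  simp only [curlc]
  rw [pd3_const_mul _ c (hw' _), pd3_const_mul _ c (hw' _)]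
  ring

lemma curlc_sub (hw : ∀ j, ContDiffAt ℝ ∞ (w j) x) (hv : ∀ j, ContDiffAt ℝ ∞ (v j) x)
    (i : Fin 3) : curlc (fun j y => w j y - v j y) i x = curlc w i x - curlc v i x := by
  have hw' := fun j => (hw j).differentiableAt (by simp)
  have hv' := fun j => (hv j).differentiableAt (by simp)
  simp only [curlc]
  rw [pd3_sub _ (hw' _) (hv' _), pd3_sub _ (hw' _) (hv' _)]
  ring

lemma pd3_curlc (hw : ∀ j, ContDiffAt ℝ ∞ (w j) x) (a i : Fin 3) :
    pd3 a (curlc w i) x = pd3 a (pd3 (i + 1) (w (i + 2))) x - pd3 a (pd3 (i + 2) (w (i + 1))) x :=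
  pd3_sub a (differentiableAt_pd3 _ (hw _)) (differentiableAt_pd3 _ (hw _))

lemma divc_curlc (hw : ∀ j, ContDiffAt ℝ ∞ (w j) x) : divc (curlc w) x = 0 := by
  simp only [divc, Fin.sum_univ_three, pd3_curlc hw]
  have h1 := pd3_comm 0 1 (hw 2)
  have h2 := pd3_comm 0 2 (hw 1)
  have h3 := pd3_comm 1 2 (hw 0)
  simp only [Fin.isValue, zero_add, Fin.reduceAdd]
  linarith

lemma pd3_divc (hw : ∀ j, ContDiffAt ℝ ∞ (w j) x) (i : Fin 3) :
    pd3 i (divc w) x = ∑ j, pd3 i (pd3 j (w j)) x := by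
  have h := fun j => differentiableAt_pd3 j (hw j)
  simp only [Fin.sum_univ_three]
  rw [← pd3_add i (h 0) (h 1), ← pd3_add i ((h 0).fun_add (h 1)) (h 2)]
  congr 1
  ext y
  simp [divc, Fin.sum_univ_three]

lemma curlc_curlc (hw : ∀ j, ContDiffAt ℝ ∞ (w j) x) (i : Fin 3) :
    curlc (curlc w) i x = pd3 i (divc w) x - lap (w i) x := by
  rw [curlc, pd3_curlc hw, pd3_curlc hw, pd3_divc hw, lap, Fin.sum_univ_three, Fin.sum_univ_three]
  have h := fun i j => pd3_comm i j (hw i)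
  fin_cases i
  · have h1 := h 1 0
    have h2 := h 2 0
    simp only [Fin.isValue, Fin.zero_eta, zero_add, Fin.reduceAdd]
    linarith
  · have h1 := h 0 1
    have h2 := h 2 1
    simp only [Fin.isValue, Fin.mk_one, Fin.reduceAdd]
    linarith
  · have h1 := h 0 2
    have h2 := h 1 2
    simp only [Fin.isValue, Fin.reduceFinMk, Fin.reduceAdd]
    linarith

lemma helm_pd3 (k : ℝ) (j : Fin 3) {f : E3 → ℝ} (hf : ContDiff ℝ ∞ f) (x : E3) :
    helm k (pd3 j f) x = pd3 j (helm k f) x := by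
  have h2 := fun i => differentiableAt_pd3 i (contDiffAt_pd3 i (hf.contDiffAt (x := x)))
  have hcomm : ∀ i, pd3 i (pd3 i (pd3 j f)) x = pd3 j (pd3 i (pd3 i f)) x := by
    intro i
    have h : pd3 i (pd3 j f) = pd3 j (pd3 i f) := funext fun y => pd3_comm i j hf.contDiffAt
    rw [h, pd3_comm i j (contDiff_pd3 i hf).contDiffAt]
  have hd := (hf.contDiffAt (x := x)).differentiableAt (by simp)
  have e : helm k f = fun y => ((pd3 0 (pd3 0 f) y + pd3 1 (pd3 1 f) y) + pd3 2 (pd3 2 f) y)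
      + k ^ 2 * f y := by
    ext y
    simp [helm, lap, Fin.sum_univ_three]
  rw [e, pd3_add j (((h2 0).fun_add (h2 1)).fun_add (h2 2)) (hd.const_mul _),
    pd3_add j ((h2 0).fun_add (h2 1)) (h2 2), pd3_add j (h2 0) (h2 1), pd3_const_mul j _ hd]
  simp only [helm, lap, Fin.sum_univ_three, hcomm]

lemma helm_eq_zero_of_curlc_eq {l : ℝ} (hl : l ≠ 0)
    (hw : ∀ᶠ y in 𝓝 x, ∀ j, ContDiffAt ℝ ∞ (w j) y)
    (h : ∀ᶠ y in 𝓝 x, ∀ j, curlc w j y = l * w j y) (i : Fin 3) : helm |l| (w i) x = 0 := by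
  have hc : ∀ᶠ y in 𝓝 x, ∀ j, curlc w j =ᶠ[𝓝 y] fun z => l * w j z := by
    filter_upwards [h.eventually_nhds] with y hy j
    filter_upwards [hy] with z hz using hz j
  have hdiv : divc w =ᶠ[𝓝 x] fun _ => 0 := by
    filter_upwards [hw, hc] with y hwy hcy
    have h1 := divc_curlc hwy
    have h2 : divc (curlc w) y = l * divc w y := by
      rw [divc, divc, Finset.mul_sum]
      refine Finset.sum_congr rfl fun j _ => ?_
      rw [(pd3_congr j (hcy j)).eq_of_nhds, pd3_const_mul j l ((hwy j).differentiableAt (by simp))]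
    rw [h1] at h2
    exact (mul_eq_zero.1 h2.symm).resolve_left hl
  have hwx := hw.self_of_nhds
  have h1 := curlc_curlc hwx i
  rw [(curlc_congr hc.self_of_nhds i).eq_of_nhds, curlc_const_mul l hwx, h.self_of_nhds i,
    (pd3_congr i hdiv).eq_of_nhds] at h1
  have h3 : pd3 i (fun _ : E3 => (0 : ℝ)) x = 0 := by simp [pd3]
  rw [h3] at h1
  rw [helm, sq_abs]
  linarith

/-- The projector onto Beltrami fields, acting on solutions of the Helmholtz equation. -/
def proj (l : ℝ) (w : Fin 3 → E3 → ℝ) (i : Fin 3) (x : E3) : ℝ :=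
  1 / (2 * l ^ 2) * (curlc (curlc w) i x + l * curlc w i x)

lemma contDiffAt_proj (l : ℝ) (hw : ∀ j, ContDiffAt ℝ ∞ (w j) x) (i : Fin 3) :
    ContDiffAt ℝ ∞ (proj l w i) x :=
  contDiffAt_const.mul ((contDiffAt_curlc (contDiffAt_curlc hw) i).add
    (contDiffAt_const.mul (contDiffAt_curlc hw i)))

lemma proj_sub (l : ℝ) (hw : ∀ᶠ y in 𝓝 x, ∀ j, ContDiffAt ℝ ∞ (w j) y)
    (hv : ∀ᶠ y in 𝓝 x, ∀ j, ContDiffAt ℝ ∞ (v j) y) (i : Fin 3) :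
    proj l (fun j y => w j y - v j y) i x = proj l w i x - proj l v i x := by
  have h1 : ∀ j, curlc (fun j y => w j y - v j y) j =ᶠ[𝓝 x]
      fun y => curlc w j y - curlc v j y := by
    intro j
    filter_upwards [hw, hv] with y hwy hvy using curlc_sub hwy hvy j
  have hwx := hw.self_of_nhds
  have hvx := hv.self_of_nhds
  simp only [proj]
  rw [(curlc_congr h1 i).eq_of_nhds, curlc_sub (contDiffAt_curlc hwx) (contDiffAt_curlc hvx),
    curlc_sub hwx hvx]
  ring

lemma proj_eq_self {l : ℝ} (hl : l ≠ 0) (hw : ∀ j, ContDiffAt ℝ ∞ (w j) x)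
    (h : ∀ᶠ y in 𝓝 x, ∀ j, curlc w j y = l * w j y) (i : Fin 3) : proj l w i x = w i x := by
  have hc : ∀ j, curlc w j =ᶠ[𝓝 x] fun z => l * w j z := fun j => by
    filter_upwards [h] with z hz using hz j
  rw [proj, (curlc_congr hc i).eq_of_nhds, curlc_const_mul l hw, h.self_of_nhds i]
  field_simp
  ring

lemma curlc_proj {l : ℝ} (hw : ∀ j, ContDiff ℝ ∞ (w j)) (hk : ∀ j x, helm |l| (w j) x = 0)
    (i : Fin 3) (x : E3) : curlc (proj l w) i x = l * proj l w i x := by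
  have hwa := fun (j : Fin 3) (y : E3) => (hw j).contDiffAt (x := y)
  have hA := fun (j : Fin 3) (y : E3) => contDiffAt_curlc (fun i => hwa i y) j
  have hB := fun (j : Fin 3) (y : E3) => contDiffAt_curlc (fun i => hA i y) j
  have hz : ∀ j, helm |l| (w j) = fun _ => 0 := fun j => funext (hk j)
  have hpz : ∀ j, pd3 j (fun _ : E3 => (0 : ℝ)) x = 0 := fun j => by simp [pd3]
  have hAk : ∀ j, helm |l| (curlc w j) x = 0 := by
    intro j
    have := helm_sub |l| (contDiffAt_pd3 (j + 1) (hwa (j + 2) x))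
      (contDiffAt_pd3 (j + 2) (hwa (j + 1) x))
    rw [helm_pd3 _ _ (hw _), helm_pd3 _ _ (hw _), hz, hz, hpz, hpz, sub_zero] at this
    exact this
  have hd : divc (curlc w) = fun _ => 0 := funext fun y => divc_curlc fun j => hwa j y
  have hcc := curlc_curlc (fun j => hA j x) i
  have hl := hAk i
  rw [helm, sq_abs] at hl
  rw [hd, hpz] at hcc
  change curlc (fun j y => 1 / (2 * l ^ 2) * (curlc (curlc w) j y + l * curlc w j y)) i x = _
  rw [curlc_const_mul _ (fun j => (hB j x).add (contDiffAt_const.mul (hA j x))),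
    curlc_add (fun j => hB j x) (fun j => contDiffAt_const.mul (hA j x)),
    curlc_const_mul _ (fun j => hA j x), hcc, proj]
  linear_combination (-1 / (2 * l ^ 2)) * hl

lemma norm_iteratedFDeriv_curlc_le (hw : ∀ j, ContDiffAt ℝ ∞ (w j) x) {n : ℕ} {B : ℝ}
    (hB : ∀ j, ‖iteratedFDeriv ℝ (n + 1) (w j) x‖ ≤ B) (i : Fin 3) :
    ‖iteratedFDeriv ℝ n (curlc w i) x‖ ≤ 2 * B := by
  have h := fun a b => (contDiffAt_pd3 a (hw b)).of_le (m := n) (mod_cast le_top)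
  have e : iteratedFDeriv ℝ n (curlc w i) x = _ :=
    iteratedFDeriv_sub_apply (h (i + 1) (i + 2)) (h (i + 2) (i + 1))
  rw [e]
  have h1 := norm_iteratedFDeriv_pd3_le (i + 1) n (hw (i + 2))
  have h2 := norm_iteratedFDeriv_pd3_le (i + 2) n (hw (i + 1))
  linarith [norm_sub_le (iteratedFDeriv ℝ n (pd3 (i + 1) (w (i + 2))) x)
    (iteratedFDeriv ℝ n (pd3 (i + 2) (w (i + 1))) x), hB (i + 1), hB (i + 2)]

lemma norm_iteratedFDeriv_proj_le (l : ℝ) (hw : ∀ j, ContDiffAt ℝ ∞ (w j) x) {n : ℕ} {B : ℝ}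
    (hB : ∀ m ≤ n + 2, ∀ j, ‖iteratedFDeriv ℝ m (w j) x‖ ≤ B) (i : Fin 3) :
    ‖iteratedFDeriv ℝ n (proj l w i) x‖ ≤ 1 / (2 * l ^ 2) * (4 + 2 * |l|) * B := by
  have hA := contDiffAt_curlc hw
  have hC := contDiffAt_curlc hA
  have hle : ∀ {f : E3 → ℝ}, ContDiffAt ℝ ∞ f x → ContDiffAt ℝ n f x := fun h =>
    h.of_le (mod_cast le_top)
  have b1 : ∀ j, ‖iteratedFDeriv ℝ (n + 1) (curlc w j) x‖ ≤ 2 * B :=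
    norm_iteratedFDeriv_curlc_le hw (hB (n + 2) le_rfl)
  have b2 : ‖iteratedFDeriv ℝ n (curlc w i) x‖ ≤ 2 * B :=
    norm_iteratedFDeriv_curlc_le hw (hB (n + 1) (by omega)) i
  have b3 : ‖iteratedFDeriv ℝ n (curlc (curlc w) i) x‖ ≤ 2 * (2 * B) :=
    norm_iteratedFDeriv_curlc_le hA b1 i
  have e : proj l w i = (1 / (2 * l ^ 2)) • (curlc (curlc w) i + l • curlc w i) := rfl
  have hs : ContDiffAt ℝ ∞ (l • curlc w i) x := contDiffAt_const.smul (hA i)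
  have hsum : ContDiffAt ℝ ∞ (curlc (curlc w) i + l • curlc w i) x := (hC i).add hs
  rw [e, iteratedFDeriv_const_smul_apply (hle hsum),
    iteratedFDeriv_add_apply (hle (hC i)) (hle hs), iteratedFDeriv_const_smul_apply (hle (hA i)),
    norm_smul, Real.norm_of_nonneg (by positivity), mul_assoc]
  refine mul_le_mul_of_nonneg_left ?_ (by positivity)
  refine (norm_add_le _ _).trans ?_
  rw [norm_smul, Real.norm_eq_abs]
  have := mul_le_mul_of_nonneg_left b2 (abs_nonneg l)
  linarith

lemma norm_iteratedFDeriv_le_sum {F : E3 → E3} (hF : ∀ i, ContDiffAt ℝ ∞ (fun y => F y i) x)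
    (n : ℕ) : ‖iteratedFDeriv ℝ n F x‖ ≤ ∑ i, ‖iteratedFDeriv ℝ n (fun y => F y i) x‖ := by
  set T : Fin 3 → ℝ →L[ℝ] E3 := fun i =>
    ContinuousLinearMap.toSpanSingleton ℝ (EuclideanSpace.single i 1 : E3) with hT
  have hTn : ∀ i, ‖T i‖ = 1 := fun i => by simp [hT]
  have e : F = (fun y => T 0 (F y 0) + T 1 (F y 1)) + fun y => T 2 (F y 2) := by
    ext y i
    fin_cases i <;> simp [hT]
  have hG : ∀ i, ContDiffAt ℝ n (fun y => T i (F y i)) x := fun i =>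
    (T i).contDiff.contDiffAt.comp x ((hF i).of_le (mod_cast le_top))
  have hb : ∀ i, ‖iteratedFDeriv ℝ n (fun y => T i (F y i)) x‖
      ≤ ‖iteratedFDeriv ℝ n (fun y => F y i) x‖ := by
    intro i
    have := (T i).norm_iteratedFDeriv_comp_left (n := n) (hF i) (mod_cast le_top)
    rwa [hTn, one_mul] at this
  conv_lhs => rw [e]
  rw [iteratedFDeriv_add_apply ((hG 0).add (hG 1)) (hG 2),
    fun_iteratedFDeriv_add_apply (hG 0) (hG 1), Fin.sum_univ_three]
  refine (norm_add_le _ _).trans (add_le_add ((norm_add_le _ _).trans ?_) (hb 2))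
  exact add_le_add (hb 0) (hb 1)

end VectorFields

section Approximation

lemma isPreconnected_thickening {s : Set E3} (hs : IsPreconnected s) (ε : ℝ) :
    IsPreconnected (thickening ε s) := by
  have h := (hs.prod (convex_ball (0 : E3) ε).isPreconnected).image (fun p : E3 × E3 => p.1 + p.2)
    continuous_add.continuousOn
  rwa [Set.add_image_prod, add_ball_zero] at h

lemma exists_compact_nbhd {K K' : Set E3} (hK : IsOpen K) (hKb : Bornology.IsBounded K)
    (hKc : IsPreconnected Kᶜ) (hK' : IsCompact K') (hsub : K' ⊆ K) :
    ∃ L, IsCompact L ∧ IsPreconnected Lᶜ ∧ L ⊆ K ∧ ∃ r > 0, ∀ x ∈ K', ball x r ⊆ L := by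
  obtain ⟨d, hd, hdK⟩ := hK'.exists_cthickening_subset_open hK hsub
  have hLK : (thickening (d / 2) Kᶜ)ᶜ ⊆ K :=
    compl_subset_comm.1 (self_subset_thickening (half_pos hd) _)
  refine ⟨(thickening (d / 2) Kᶜ)ᶜ, ?_, ?_, hLK, d / 2, half_pos hd, fun x hx y hy hyL => ?_⟩
  · exact Metric.isCompact_of_isClosed_isBounded isOpen_thickening.isClosed_compl (hKb.subset hLK)
  · rw [compl_compl]
    exact isPreconnected_thickening hKc _
  · obtain ⟨z, hz, hyz⟩ := mem_thickening_iff.1 hyL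
    refine hz (hdK (thickening_subset_cthickening _ _ (mem_thickening_iff.2 ⟨x, hx, ?_⟩)))
    have := dist_triangle z y x
    rw [dist_comm z y] at this
    rw [mem_ball] at hy
    linarith

lemma decaying_iteratedFDeriv_le {k : ℝ} {w : E3 → ℝ} (hw : w ∈ decaying k) (n : ℕ) :
    ∃ B, 0 ≤ B ∧ ∀ x, ∀ j ≤ n, ‖iteratedFDeriv ℝ j w x‖ ≤ B / (1 + ‖x‖) := by
  obtain ⟨hws, hwk, C, hC⟩ := hw
  obtain ⟨M, hM, hest⟩ := exists_interior_estimate k one_pos n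
  have hC0 : 0 ≤ C := by simpa using (abs_nonneg _).trans (hC 0)
  set V := volume.real (ball (0 : E3) (3 * 1)) with hV
  refine ⟨M * (4 * C * V), by positivity, fun x j hj => ?_⟩
  have hb : ∀ y ∈ ball x (3 * 1), ‖|w y|‖ ≤ 4 * C / (1 + ‖x‖) := by
    intro y hy
    rw [Real.norm_eq_abs, abs_abs]
    refine (hC y).trans ?_
    rw [mem_ball, dist_comm, dist_eq_norm] at hy
    have h1 := norm_le_norm_add_norm_sub y x
    rw [norm_sub_rev] at h1
    rw [div_le_div_iff₀ (by positivity) (by positivity)]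
    have h2 : 1 + ‖x‖ ≤ 4 * (1 + ‖y‖) := by linarith [norm_nonneg y]
    nlinarith [mul_le_mul_of_nonneg_left h2 hC0]
  have hvol : volume.real (ball x (3 * 1)) = V := by
    rw [hV, measureReal_def, measureReal_def, Measure.addHaar_ball_center]
  have hint := norm_setIntegral_le_of_norm_le_const (μ := volume)
    (measure_ball_lt_top (x := x) (r := 3 * 1)) hb
  rw [hvol] at hint
  have hi : IntegrableOn w (ball x (3 * 1)) :=
    (hws.continuous.locallyIntegrable.integrableOn_isCompact
      (isCompact_closedBall x (3 * 1))).mono_set ball_subset_closedBall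
  refine (hest w x (fun y _ => hws.contDiffAt) (fun y _ => hwk y) hi j hj).trans ?_
  calc M * ∫ y in ball x (3 * 1), |w y| ≤ M * (4 * C / (1 + ‖x‖) * V) :=
        mul_le_mul_of_nonneg_left ((le_abs_self _).trans hint) hM
    _ = M * (4 * C * V) / (1 + ‖x‖) := by ring

lemma proj_decay (l : ℝ) {w : Fin 3 → E3 → ℝ} (hw : ∀ i, w i ∈ decaying |l|) :
    ∃ C, 0 ≤ C ∧ ∀ i x, |proj l w i x| ≤ C / (1 + ‖x‖) := by
  choose B hB0 hB using fun i => decaying_iteratedFDeriv_le (hw i) 2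
  have hle : ∀ i, B i ≤ ∑ j, B j := fun i =>
    Finset.single_le_sum (fun j _ => hB0 j) (Finset.mem_univ i)
  have hS := Finset.sum_nonneg fun j (_ : j ∈ Finset.univ) => hB0 j
  refine ⟨1 / (2 * l ^ 2) * (4 + 2 * |l|) * ∑ j, B j, by positivity, fun i x => ?_⟩
  have h := norm_iteratedFDeriv_proj_le (n := 0) l (fun j => (hw j).1.contDiffAt (x := x))
    (B := (∑ j, B j) / (1 + ‖x‖)) (fun m hm j => (hB j x m (by omega)).trans ?_) i
  · rwa [norm_iteratedFDeriv_zero, Real.norm_eq_abs, ← mul_div_assoc] at h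
  · have := hle j
    gcongr

lemma toE3_apply (a : Fin 3 → ℝ) (i : Fin 3) : toE3 a i = a i := rfl

/-- Approximation of a local Beltrami field by a global one decaying at infinity. -/
theorem exists_global_approx {l : ℝ} (hl : l ≠ 0) {K : Set E3} (hK : IsOpen K)
    (hKb : Bornology.IsBounded K) (hKc : IsPreconnected Kᶜ) {v : E3 → E3}
    (hv : ContDiffOn ℝ ∞ v K) (hvl : ∀ x ∈ K, curl3 v x = l • v x) {K' : Set E3}
    (hsub : K' ⊆ K) (hK' : IsCompact K') (m : ℕ) {δ : ℝ} (hδ : 0 < δ) :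
    ∃ (u : E3 → E3) (C : ℝ), 0 < C ∧ ContDiff ℝ ∞ u ∧ (∀ x, curl3 u x = l • u x) ∧
      (∀ x, ‖u x‖ ≤ C / (1 + ‖x‖)) ∧
      ∀ x ∈ K', ∀ j ≤ m, ‖iteratedFDeriv ℝ j (u - v) x‖ ≤ δ := by
  obtain ⟨L, hL, hLc, hLK, r, hr, hrL⟩ := exists_compact_nbhd hK hKb hKc hK' hsub
  have hvs : ∀ x ∈ K, ∀ i, ContDiffAt ℝ ∞ (fun y => v y i) x := fun x hx =>
    contDiffAt_euclidean.1 (hv.contDiffAt (hK.mem_nhds hx))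
  have hve : ∀ x ∈ K, ∀ᶠ y in 𝓝 x, ∀ i, ContDiffAt ℝ ∞ (fun z => v z i) y := fun x hx => by
    filter_upwards [hK.mem_nhds hx] with y hy using hvs y hy
  have hvc : ∀ x ∈ K, ∀ᶠ y in 𝓝 x, ∀ i, curlc (fun j z => v z j) i y = l * v y i := by
    intro x hx
    filter_upwards [hK.mem_nhds hx] with y hy i
    rw [← curl3_apply, hvl y hy]
    rfl
  have hvk : ∀ x ∈ K, ∀ i, helm |l| (fun y => v y i) x = 0 := fun x hx i =>
    helm_eq_zero_of_curlc_eq hl (hve x hx) (hvc x hx) i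
  obtain ⟨M, hM, hest⟩ := exists_interior_estimate |l| (show 0 < r / 3 by positivity) (m + 2)
  rw [mul_div_cancel₀ r three_ne_zero] at hest
  set c := 1 / (2 * l ^ 2) * (4 + 2 * |l|) with hc
  have hc0 : 0 < c := by positivity
  set η := δ / (3 * c * (M + 1)) with hη
  have hη0 : 0 < η := by positivity
  choose w hw hwv using fun i : Fin 3 => exists_decaying_approx (abs_pos.2 hl) hL hLc hK hLK
    (fun x hx => hvs x hx i) (fun x hx => hvk x hx i) hη0
  have hws : ∀ i, ContDiff ℝ ∞ (w i) := fun i => (hw i).1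
  have hwk : ∀ i x, helm |l| (w i) x = 0 := fun i => (hw i).2.1
  obtain ⟨C, hC, hdecay⟩ := proj_decay l hw
  have hus : ∀ i, ContDiff ℝ ∞ (proj l w i) := fun i =>
    contDiff_iff_contDiffAt.2 fun x => contDiffAt_proj l (fun j => (hws j).contDiffAt) i
  refine ⟨fun x => toE3 fun i => proj l w i x, 3 * C + 1, by positivity,
    contDiff_euclidean.2 hus, fun x => ?_, fun x => ?_, fun x hx j hj => ?_⟩
  · ext i
    rw [curl3_apply]
    exact curlc_proj hws hwk i x
  · have h := norm_iteratedFDeriv_le_sum (F := fun x => toE3 fun i => proj l w i x) (x := x)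
      (fun i => (hus i).contDiffAt) 0
    simp only [norm_iteratedFDeriv_zero, toE3_apply, Real.norm_eq_abs] at h
    refine h.trans ((Finset.sum_le_sum fun i _ => hdecay i x).trans ?_)
    rw [Finset.sum_const, Finset.card_univ, Fintype.card_fin, nsmul_eq_mul, ← mul_div_assoc]
    gcongr
    push_cast
    linarith
  · have hxK := hsub hx
    have hball : ball x r ⊆ K := (hrL x hx).trans hLK
    have hes : ∀ y ∈ K, ∀ i, ContDiffAt ℝ ∞ (fun z => w i z - v z i) y := fun y hy i =>
      (hws i).contDiffAt.sub (hvs y hy i)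
    have hdiff : ∀ i, (fun y => ((fun x => toE3 fun i => proj l w i x) - v) y i) =ᶠ[𝓝 x]
        proj l (fun i z => w i z - v z i) i := by
      intro i
      filter_upwards [hK.mem_nhds hxK] with y hy
      rw [proj_sub l (Eventually.of_forall fun z j => (hws j).contDiffAt) (hve y hy) i,
        proj_eq_self hl (hvs y hy) (hvc y hy)]
      rfl
    have hbound : ∀ n ≤ j + 2, ∀ i,
        ‖iteratedFDeriv ℝ n (fun z => w i z - v z i) x‖ ≤ M * η := by
      intro n hn i
      have hcont : ContinuousOn (fun z => w i z - v z i) L := fun y hy =>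
        (hes y (hLK hy) i).continuousAt.continuousWithinAt
      have hint := hcont.integrableOn_compact hL (μ := volume)
      refine (hest _ x (fun y hy => hes y (hball hy) i) (fun y hy => ?_)
        (hint.mono_set (hrL x hx)) n (by omega)).trans (mul_le_mul_of_nonneg_left ?_ hM)
      · rw [helm_sub _ (hws i).contDiffAt (hvs y (hball hy) i), hwk, hvk y (hball hy), sub_zero]
      · exact (setIntegral_mono_set hint.abs (Eventually.of_forall fun _ => abs_nonneg _)
          (hrL x hx).eventuallyLE).trans (hwv i)
    have hF : ∀ i, ContDiffAt ℝ ∞ (fun y => ((fun x => toE3 fun i => proj l w i x) - v) y i) x :=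
      fun i => (contDiffAt_proj l (hes x hxK) i).congr_of_eventuallyEq (hdiff i)
    refine (norm_iteratedFDeriv_le_sum hF j).trans ?_
    calc _ ≤ ∑ _i : Fin 3, c * (M * η) := Finset.sum_le_sum fun i _ => by
          rw [(hdiff i).iteratedFDeriv ℝ j |>.eq_of_nhds]
          exact norm_iteratedFDeriv_proj_le l (hes x hxK) hbound i
      _ = 3 * c * M * η := by
          rw [Finset.sum_const, Finset.card_univ, Fintype.card_fin, nsmul_eq_mul]
          push_cast
          ring
      _ ≤ 3 * c * (M + 1) * η := by
          gcongr
          linarith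
      _ = δ := by
          rw [hη]
          field_simp

end Approximation

end Beltrami

/-- Global approximation theorem for Beltrami fields with sharp decay at infinity. -/
theorem stmt10
    (lam : ℝ) (hlam : lam ≠ 0)
    (K : Set E3) (hKopen : IsOpen K) (hKbdd : Bornology.IsBounded K)
    (hKcompl : IsConnected Kᶜ)
    (v : E3 → E3) (hv : ContDiffOn ℝ (⊤ : ℕ∞) v K)
    (hbeltrami : ∀ x ∈ K, curl3 v x = lam • v x)
    (K' : Set E3) (hK'sub : K' ⊆ K) (hK'cpt : IsCompact K')
    (m : ℕ) (δ₀ : ℝ) (hδ₀ : 0 < δ₀) :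
    ∃ (u : E3 → E3) (C : ℝ), 0 < C ∧
      ContDiff ℝ (⊤ : ℕ∞) u ∧
      (∀ x, curl3 u x = lam • u x) ∧
      (∀ x, ‖u x‖ ≤ C / (1 + ‖x‖)) ∧
      (∀ x ∈ K', ∀ j ≤ m, ‖iteratedFDeriv ℝ j (u - v) x‖ ≤ δ₀) := by
  exact Beltrami.exists_global_approx hlam hKopen hKbdd hKcompl.isPreconnected hv hbeltrami hK'sub
    hK'cpt m hδ₀
end
end
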